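/- Let V be an optimal computer and let T ∈ (0,1). If the free energy F_V(T) = −T log₂ Z_V(T) is a computable real, then T is weakly Chaitin T-random and T-compressible. -/

import Mathlib

open Filter Topology

/-- A set of finite binary strings is prefix-free if no string in it is a
proper prefix of another string in it. -/
def PrefixFree (S : Set (List Bool)) : Prop :=
  ∀ p ∈ S, ∀ q ∈ S, p <+: q → p = q

/-- A computer: a partial recursive function from finite binary strings to
finite binary strings whose domain is a nonempty prefix-free set. -/
structure Computer where
  f : List Bool →. List Bool
  partrec : Partrec f
  dom_nonempty : f.Dom.Nonempty
  dom_prefixFree : PrefixFree f.Dom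

/-- A computer `U` is optimal if for each computer `C` there is `d ∈ ℕ` such
that every `p ∈ Dom C` admits `q` with `U(q) = C(p)` and `|q| ≤ |p| + d`. -/
def Optimal (U : Computer) : Prop :=
  ∀ C : Computer, ∃ d : ℕ, ∀ p ∈ C.f.Dom,
    ∃ q : List Bool, U.f q = C.f p ∧ q.length ≤ p.length + d

/-- `H_C(s)`: the length of a shortest program for `C` printing `s`. -/
noncomputable def complexity (C : Computer) (s : List Bool) : ℕ :=
  sInf {n | ∃ p : List Bool, s ∈ C.f p ∧ p.length = n}

/-- The `i`-th bit (for `i = 0, 1, 2, …`) of the base-two expansion of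
`α - ⌊α⌋` with infinitely many zeros. -/
noncomputable def bitOf (α : ℝ) (i : ℕ) : Bool :=
  decide (⌊(α - ⌊α⌋) * 2 ^ (i + 1)⌋ % 2 = 1)

/-- `α↾n`: the first `n` bits of the base-two expansion of `α - ⌊α⌋`
with infinitely many zeros. -/
noncomputable def firstBits (α : ℝ) (n : ℕ) : List Bool :=
  (List.range n).map (bitOf α)

/-- A real `α` is computable if some total recursive `f : ℕ⁺ → ℚ` satisfies
`|α - f n| < 1/n` for all `n ≥ 1`. -/
def ComputableReal (α : ℝ) : Prop :=
  ∃ f : ℕ → ℚ, Computable f ∧ ∀ n : ℕ, 0 < n → |α - (f n : ℝ)| < 1 / n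

/-- `α` is weakly Chaitin `T`-random (w.r.t. the computer `U`). -/
def WeaklyChaitinTRandom (U : Computer) (T α : ℝ) : Prop :=
  ∃ c : ℕ, ∀ n : ℕ, 0 < n → T * n - c ≤ (complexity U (firstBits α n) : ℝ)

/-- `α` is Chaitin `T`-random (w.r.t. the computer `U`). -/
def ChaitinTRandom (U : Computer) (T α : ℝ) : Prop :=
  Tendsto (fun n : ℕ => (complexity U (firstBits α n) : ℝ) - T * n) atTop atTop

/-- `α` is `T`-compressible (w.r.t. the computer `U`): `H(α↾n) ≤ Tn + o(n)`. -/
def TCompressible (U : Computer) (T α : ℝ) : Prop :=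
  ∃ g : ℕ → ℝ, Tendsto (fun n : ℕ => g n / n) atTop (nhds 0) ∧
    ∀ n : ℕ, 0 < n → (complexity U (firstBits α n) : ℝ) ≤ T * n + g n

/-- The Boltzmann factor `2^(-|p|/T)` of a program `p`. -/
noncomputable def boltzmann (T : ℝ) (p : List Bool) : ℝ :=
  (2 : ℝ) ^ (-(p.length : ℝ) / T)

/-- Partition function `Z_C(T) = Σ_{p ∈ Dom C} 2^(-|p|/T)`. -/
noncomputable def Zfun (C : Computer) (T : ℝ) : ℝ :=
  ∑' p : C.f.Dom, boltzmann T p.1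

/-- Free energy `F_C(T) = -T log₂ Z_C(T)`. -/
noncomputable def Ffun (C : Computer) (T : ℝ) : ℝ :=
  -T * Real.logb 2 (Zfun C T)

/-- Energy `E_C(T) = Z_C(T)⁻¹ Σ_{p ∈ Dom C} |p| 2^(-|p|/T)`. -/
noncomputable def Efun (C : Computer) (T : ℝ) : ℝ :=
  (Zfun C T)⁻¹ * ∑' p : C.f.Dom, (p.1.length : ℝ) * boltzmann T p.1

/-- Statistical mechanical entropy `S_C(T) = (E_C(T) - F_C(T))/T`. -/
noncomputable def Sfun (C : Computer) (T : ℝ) : ℝ :=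
  (Efun C T - Ffun C T) / T

/-- `𝒵(V)`: the set of `T ∈ (0,1)` with `Z_V(T)` computable. -/
def setZ (V : Computer) : Set ℝ := {T | T ∈ Set.Ioo 0 1 ∧ ComputableReal (Zfun V T)}

/-- `ℱ(V)`: the set of `T ∈ (0,1)` with `F_V(T)` computable. -/
def setF (V : Computer) : Set ℝ := {T | T ∈ Set.Ioo 0 1 ∧ ComputableReal (Ffun V T)}

/-- `ℰ(V)`: the set of `T ∈ (0,1)` with `E_V(T)` computable. -/
def setE (V : Computer) : Set ℝ := {T | T ∈ Set.Ioo 0 1 ∧ ComputableReal (Efun V T)}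

/-- `𝒮(V)`: the set of `T ∈ (0,1)` with `S_V(T)` computable. -/
def setS (V : Computer) : Set ℝ := {T | T ∈ Set.Ioo 0 1 ∧ ComputableReal (Sfun V T)}

/-- `FP_w` (w.r.t. the optimal computer `U` fixing `H`): the set of `T ∈ (0,1)`
that are weakly Chaitin `T`-random and `T`-compressible. -/
def FPw (U : Computer) : Set ℝ :=
  {T | T ∈ Set.Ioo 0 1 ∧ WeaklyChaitinTRandom U T T ∧ TCompressible U T T}

/-- `FP` (w.r.t. the optimal computer `U` fixing `H`): the set of `T ∈ (0,1)`
that are Chaitin `T`-random and `T`-compressible. -/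
def FP (U : Computer) : Set ℝ :=
  {T | T ∈ Set.Ioo 0 1 ∧ ChaitinTRandom U T T ∧ TCompressible U T T}

/-- A computer is physically reasonable if its domain contains two strings of
different lengths. -/
def PhysicallyReasonable (C : Computer) : Prop :=
  ∃ p ∈ C.f.Dom, ∃ q ∈ C.f.Dom, p.length ≠ q.length

/-- A computable measure machine: `Z_C(1)` is a computable real. -/
def ComputableMeasureMachine (C : Computer) : Prop :=
  ComputableReal (Zfun C 1)

/-- `D` is the composition `C₀ ⊘ C₁ ⊘ ⋯ ⊘ C_{N-1}`: its domain consists of the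
concatenations `p₀p₁⋯p_{N-1}` with each `pᵢ ∈ Dom Cᵢ`, and on such a
concatenation it returns `C₀(p₀)`. -/
def IsComposition {N : ℕ} (C : Fin N → Computer) (hN : 0 < N) (D : Computer) : Prop :=
  (∀ l, l ∈ D.f.Dom ↔
      ∃ ps : Fin N → List Bool, (∀ i, ps i ∈ (C i).f.Dom) ∧ l = (List.ofFn ps).flatten) ∧
  (∀ ps : Fin N → List Bool, (∀ i, ps i ∈ (C i).f.Dom) →
      D.f ((List.ofFn ps).flatten) = (C ⟨0, hN⟩).f (ps ⟨0, hN⟩))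

/-- A sequence of computers is recursive if a single partial recursive function
uniformly computes all of them. -/
def RecursiveSeq (V : ℕ → Computer) : Prop :=
  ∃ F : ℕ × List Bool →. List Bool, Partrec F ∧ ∀ n p, (V n).f p = F (n, p)

section CompBasics
variable {α β σ : Type} [Primcodable α] [Primcodable β] [Primcodable σ]

theorem cAdd {f g : α → ℕ} (hf : Computable f) (hg : Computable g) :
    Computable fun a => f a + g a := Primrec.nat_add.to_comp.comp hf hg
theorem cMul {f g : α → ℕ} (hf : Computable f) (hg : Computable g) :
    Computable fun a => f a * g a := Primrec.nat_mul.to_comp.comp hf hg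
theorem cSub {f g : α → ℕ} (hf : Computable f) (hg : Computable g) :
    Computable fun a => f a - g a := Primrec.nat_sub.to_comp.comp hf hg
theorem cDiv {f g : α → ℕ} (hf : Computable f) (hg : Computable g) :
    Computable fun a => f a / g a := Primrec.nat_div.to_comp.comp hf hg
theorem cMod {f g : α → ℕ} (hf : Computable f) (hg : Computable g) :
    Computable fun a => f a % g a := Primrec.nat_mod.to_comp.comp hf hg
theorem cLe {f g : α → ℕ} (hf : Computable f) (hg : Computable g) :
    Computable fun a => decide (f a ≤ g a) := Primrec.nat_le.decide.to_comp.comp hf hg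
theorem cLt {f g : α → ℕ} (hf : Computable f) (hg : Computable g) :
    Computable fun a => decide (f a < g a) := Primrec.nat_lt.decide.to_comp.comp hf hg
theorem cEq [DecidableEq β] {f g : α → β} (hf : Computable f) (hg : Computable g) :
    Computable fun a => decide (f a = g a) :=
  Primrec.eq.decide.to_comp.comp hf hg
theorem cAnd {f g : α → Bool} (hf : Computable f) (hg : Computable g) :
    Computable fun a => f a && g a := Primrec.and.to_comp.comp hf hg

theorem cPow {f g : α → ℕ} (hf : Computable f) (hg : Computable g) :
    Computable fun a => f a ^ g a := by
  have : Computable fun a => Nat.rec (motive := fun _ => ℕ) 1 (fun _ y => y * f a) (g a) :=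
    Computable.nat_rec hg (Computable.const 1)
      (cMul (Computable.snd.comp Computable.snd) (hf.comp Computable.fst)).to₂
  refine this.of_eq fun a => ?_
  induction g a with
  | zero => simp
  | succ n ih => rw [pow_succ, ← ih]

theorem cSum {f : α → ℕ} {g : α → ℕ → ℕ} (hf : Computable f) (hg : Computable₂ g) :
    Computable fun a => ∑ i ∈ Finset.range (f a), g a i := by
  have : Computable fun a =>
      Nat.rec (motive := fun _ => ℕ) 0 (fun n y => y + g a n) (f a) :=
    Computable.nat_rec hf (Computable.const 0)
      (cAdd (Computable.snd.comp Computable.snd)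
        (hg.comp Computable.fst (Computable.fst.comp Computable.snd))).to₂
  refine this.of_eq fun a => ?_
  induction f a with
  | zero => simp
  | succ n ih => rw [Finset.sum_range_succ, ← ih]

/-- Unbounded search for a witness of a computable check. -/
theorem exists_search {chk : α → β → Bool} (h : Computable₂ chk) :
    ∃ f : α →. β, Partrec f ∧ (∀ a b, b ∈ f a → chk a b = true) ∧
      (∀ a b, chk a b = true → (f a).Dom) := by
  let g : α → ℕ → Option β := fun a n =>
    (Encodable.decode (α := β) n).bind fun b => bif chk a b then some b else none
  have hg : Computable₂ g := by
    refine Computable.option_bind (Computable.decode.comp Computable.snd) ?_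
    exact (Computable.cond (h.comp (Computable.fst.comp Computable.fst) Computable.snd)
      (Computable.option_some.comp Computable.snd) (Computable.const none)).to₂
  refine ⟨fun a => Nat.rfindOpt (g a), Partrec.rfindOpt hg, ?_, ?_⟩
  · intro a b hb
    obtain ⟨n, hn⟩ := Nat.rfindOpt_spec hb
    simp only [g, Option.mem_def, Option.bind_eq_some_iff] at hn
    obtain ⟨b', _, hb'⟩ := hn
    cases hc : chk a b' <;> simp [hc] at hb'
    rw [← hb']; exact hc
  · intro a b hb
    refine Nat.rfindOpt_dom.2 ⟨Encodable.encode b, b, ?_⟩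
    simp [g, hb]

end CompBasics

section RatComp

def oldEnc (q : ℚ) : ℕ := Nat.pair (Encodable.encode q.num) q.den

theorem oldEnc_eq (q : ℚ) : oldEnc q = @Encodable.encode ℚ Rat.instEncodable q := by
  cases q; rfl

/-- The encoding used by the `Primcodable ℚ` instance. -/
def newEnc (q : ℚ) : ℕ := @Encodable.encode ℚ (Primcodable.ofDenumerable ℚ).toEncodable q

open Classical in
theorem newEnc_eq (q : ℚ) : newEnc q =
    ((Finset.range (oldEnc q)).filter (fun x => x ∈ Set.range oldEnc)).card := by
  have h1 : newEnc q =
    (List.range (@Encodable.encode ℚ Rat.instEncodable q)).countP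
      (fun x => @decide (x ∈ Set.range (@Encodable.encode ℚ Rat.instEncodable))
        (@Encodable.decidableRangeEncode ℚ Rat.instEncodable x)) := rfl
  have h2 : oldEnc = @Encodable.encode ℚ Rat.instEncodable := funext oldEnc_eq
  rw [h1, h2, List.countP_eq_length_filter]
  have : ∀ (n : ℕ) (p : ℕ → Prop) [DecidablePred p], ((Finset.range n).filter p).card
    = ((List.range n).filter (fun x => decide (p x))).length := fun n p _ => rfl
  rw [this]
  congr 2
  funext x
  exact decide_eq_decide.2 Iff.rfl

theorem encode_int (z : ℤ) : (Encodable.encode z + 1) / 2 = z.natAbs ∧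
    (Encodable.encode z / 2) * ((Encodable.encode z + 1) % 2) = z.toNat := by
  cases z with
  | ofNat n =>
    have : Encodable.encode (Int.ofNat n) = 2 * n := rfl
    rw [this]; constructor
    · simp; omega
    · have : (2 * n + 1) % 2 = 1 := by omega
      rw [this]; simp
  | negSucc n =>
    have : Encodable.encode (Int.negSucc n) = 2 * n + 1 := rfl
    rw [this]; constructor
    · simp; omega
    · have : (2 * n + 1 + 1) % 2 = 0 := by omega
      rw [this]; simp

def copr (a b : ℕ) : ℕ := ∑ c ∈ Finset.range b, (1 - (a % (c + 2) + b % (c + 2)))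

theorem copr_iff {a b : ℕ} (hb : 0 < b) : copr a b = 0 ↔ Nat.Coprime a b := by
  unfold copr
  rw [Finset.sum_eq_zero_iff]
  constructor
  · intro h
    by_contra hc
    have h1 : Nat.gcd a b ≠ 1 := hc
    have h0 : 0 < Nat.gcd a b := Nat.gcd_pos_of_pos_right _ hb
    have hle : Nat.gcd a b ≤ b := Nat.gcd_le_right _ hb
    have := h (Nat.gcd a b - 2) (by simp; omega)
    have e : Nat.gcd a b - 2 + 2 = Nat.gcd a b := by omega
    rw [e, Nat.mod_eq_zero_of_dvd (Nat.gcd_dvd_left a b),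
      Nat.mod_eq_zero_of_dvd (Nat.gcd_dvd_right a b)] at this
    simp at this
  · intro h c _
    by_contra hc
    have h1 : a % (c + 2) = 0 := by omega
    have h2 : b % (c + 2) = 0 := by omega
    have := Nat.dvd_gcd (Nat.dvd_of_mod_eq_zero h1) (Nat.dvd_of_mod_eq_zero h2)
    rw [h] at this
    have := Nat.le_of_dvd one_pos this
    omega

def inR (x : ℕ) : Bool :=
  decide (0 < x.unpair.2) && decide (copr ((x.unpair.1 + 1) / 2) x.unpair.2 = 0)

theorem inR_iff (x : ℕ) : inR x = true ↔ x ∈ Set.range oldEnc := by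
  unfold inR
  rw [Bool.and_eq_true, decide_eq_true_iff, decide_eq_true_iff]
  constructor
  · rintro ⟨h1, h2⟩
    rw [copr_iff h1] at h2
    set z : ℤ := Denumerable.ofNat ℤ x.unpair.1 with hz
    have hz' : Encodable.encode z = x.unpair.1 := by rw [hz, Denumerable.encode_ofNat]
    rw [← hz', (encode_int z).1] at h2
    refine ⟨⟨z, x.unpair.2, h1.ne', h2⟩, ?_⟩
    simp only [oldEnc]
    rw [hz', Nat.pair_unpair]
  · rintro ⟨q, rfl⟩
    simp only [oldEnc, Nat.unpair_pair]
    refine ⟨q.den_pos, ?_⟩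
    rw [copr_iff q.den_pos, (encode_int _).1]
    exact q.reduced

theorem comp_unpair1 : Computable fun x : ℕ => x.unpair.1 :=
  Computable.fst.comp Primrec.unpair.to_comp
theorem comp_unpair2 : Computable fun x : ℕ => x.unpair.2 :=
  Computable.snd.comp Primrec.unpair.to_comp

theorem comp_inR : Computable inR := by
  refine cAnd (cLt (Computable.const 0) comp_unpair2) (cEq ?_ (Computable.const 0))
  refine cSum comp_unpair2 ?_
  have hc : Computable fun p : ℕ × ℕ => p.2 + 2 := cAdd Computable.snd (Computable.const 2)
  exact (cSub (Computable.const 1) (cAdd (cMod (cDiv (cAdd (comp_unpair1.comp Computable.fst)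
    (Computable.const 1)) (Computable.const 2)) hc)
    (cMod (comp_unpair2.comp Computable.fst) hc))).to₂

def cntR (x : ℕ) : ℕ := ∑ y ∈ Finset.range x, bif inR y then 1 else 0

theorem comp_cntR : Computable cntR :=
  cSum Computable.id (Computable.cond (comp_inR.comp Computable.snd)
    (Computable.const 1) (Computable.const 0)).to₂

theorem cntR_oldEnc (q : ℚ) : cntR (oldEnc q) = newEnc q := by
  classical
  rw [newEnc_eq, cntR, Finset.card_filter]
  refine Finset.sum_congr rfl fun y _ => ?_
  by_cases h : y ∈ Set.range oldEnc
  · rw [if_pos h, (inR_iff y).2 h]; rfl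
  · rw [if_neg h]
    have : inR y = false := by
      rw [← Bool.not_eq_true, inR_iff]; exact h
    rw [this]; rfl

theorem newEnc_inj {p q : ℚ} (h : newEnc p = newEnc q) : p = q :=
  @Encodable.encode_injective ℚ (Primcodable.ofDenumerable ℚ).toEncodable _ _ h

/-- The old encoding of a rational is computable. -/
theorem comp_oldEnc : Computable oldEnc := by
  have hc : Computable₂ fun (q : ℚ) (x : ℕ) => inR x && decide (cntR x = newEnc q) :=
    (cAnd (comp_inR.comp Computable.snd) (cEq (comp_cntR.comp Computable.snd)
      (Computable.encode.comp Computable.fst))).to₂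
  obtain ⟨f, hf, h1, h2⟩ := exists_search hc
  refine Partrec.of_eq_tot hf fun q => ?_
  have hd : (f q).Dom := h2 q (oldEnc q) (by
    rw [(inR_iff _).2 ⟨q, rfl⟩, cntR_oldEnc]; simp)
  obtain ⟨x, hx⟩ := Part.dom_iff_mem.1 hd
  have := h1 q x hx
  rw [Bool.and_eq_true, inR_iff, decide_eq_true_iff] at this
  obtain ⟨⟨p, rfl⟩, h⟩ := this
  rw [cntR_oldEnc] at h
  have e := newEnc_inj h
  subst e
  exact hx

theorem comp_den : Computable fun q : ℚ => q.den :=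
  (comp_unpair2.comp comp_oldEnc).of_eq fun q => by simp [oldEnc]

theorem comp_num : Computable fun q : ℚ => q.num.toNat :=
  (show Computable fun q : ℚ => ((oldEnc q).unpair.1 / 2) * (((oldEnc q).unpair.1 + 1) % 2) from
  cMul (cDiv (comp_unpair1.comp comp_oldEnc) (Computable.const 2))
    (cMod (cAdd (comp_unpair1.comp comp_oldEnc) (Computable.const 1)) (Computable.const 2))).of_eq
    fun q => by
      simp only [oldEnc, Nat.unpair_pair]
      exact (encode_int _).2

theorem exists_nat_approx {F : ℝ} (h0 : 0 ≤ F) (hF : ComputableReal F) :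
    ∃ A : ℕ → ℕ, Computable A ∧ ∀ k, (A k : ℝ) ≤ (k + 1) * F ∧ (k + 1) * F ≤ A k + 3 := by
  obtain ⟨f, hf, h⟩ := hF
  have hs : Computable fun k => f (k + 1) := hf.comp (Computable.succ)
  refine ⟨fun k => (f (k + 1)).num.toNat * (k + 1) / (f (k + 1)).den - 1,
    cSub (cDiv (cMul (comp_num.comp hs) Computable.succ) (comp_den.comp hs)) (Computable.const 1), ?_⟩
  intro k
  have hk := h (k + 1) (by omega)
  dsimp only
  generalize f (k + 1) = q at hk ⊢
  set B := q.num.toNat * (k + 1) / q.den with hB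
  have hd : (0 : ℝ) < q.den := by exact_mod_cast q.den_pos
  have hk0 : (0 : ℝ) < (k : ℝ) + 1 := by positivity
  rw [abs_lt] at hk
  push_cast at hk
  obtain ⟨hk1, hk2⟩ := hk
  have hq : (q : ℝ) = q.num / q.den := Rat.cast_def q
  set r : ℝ := (q.num.toNat : ℝ) / q.den with hr
  have hrq : (q : ℝ) ≤ r := by
    rw [hq, hr]; gcongr
    exact_mod_cast Int.self_le_toNat q.num
  have hr2 : r ≤ F + 1 / (k + 1) := by
    rcases le_total 0 q.num with hn | hn
    · have : r = q := by
        rw [hq, hr]; congr 1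
        exact_mod_cast Int.toNat_of_nonneg hn
      linarith
    · have : q.num.toNat = 0 := Int.toNat_of_nonpos hn
      rw [hr, this]; simp; positivity
  have hb1 : (B : ℝ) ≤ r * (k + 1) := by
    have : (B : ℝ) ≤ ((q.num.toNat * (k + 1) : ℕ) : ℝ) / q.den := Nat.cast_div_le
    calc (B : ℝ) ≤ _ := this
      _ = r * (k + 1) := by rw [hr]; push_cast; ring
  have hb2 : r * (k + 1) < B + 1 := by
    have : q.num.toNat * (k + 1) < q.den * (B + 1) := Nat.lt_mul_div_succ _ q.den_pos
    have : ((q.num.toNat : ℝ) * (k + 1)) < q.den * (B + 1) := by exact_mod_cast this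
    calc r * (k + 1) = (q.num.toNat * (k + 1)) / q.den := by rw [hr]; ring
      _ < B + 1 := by rw [div_lt_iff₀ hd]; linarith
  have e1 : (k + 1) * F ≤ r * (k + 1) + 1 := by
    have : F < r + 1 / (k + 1) := by linarith
    have := mul_lt_mul_of_pos_right this hk0
    rw [add_mul, one_div, inv_mul_cancel₀ hk0.ne'] at this
    linarith
  have e2 : r * (k + 1) ≤ (k + 1) * F + 1 := by
    have := mul_le_mul_of_nonneg_right hr2 hk0.le
    rw [add_mul, one_div, inv_mul_cancel₀ hk0.ne'] at this
    linarith
  rcases Nat.eq_zero_or_pos B with hB0 | hBp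
  · rw [hB0] at hb1 hb2 ⊢
    simp at hb1 hb2 ⊢
    constructor
    · positivity
    · linarith
  · have : ((B - 1 : ℕ) : ℝ) = B - 1 := by push_cast [Nat.cast_sub hBp]; ring
    rw [this]
    constructor <;> linarith
end RatComp

section Strings

def bval (l : List Bool) : ℕ := l.foldl (fun a b => 2 * a + b.toNat) 0

theorem bval_concat (l : List Bool) (b : Bool) : bval (l ++ [b]) = 2 * bval l + b.toNat := by
  simp [bval, List.foldl_append]

theorem comp_bval : Computable bval := by
  have : Primrec bval := Primrec.list_foldl Primrec.id (Primrec.const 0)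
    (Primrec.nat_add.comp (Primrec.nat_mul.comp (Primrec.const 2) (Primrec.fst.comp Primrec.snd))
      ((Primrec.dom_bool Bool.toNat).comp (Primrec.snd.comp Primrec.snd))).to₂
  exact this.to_comp

theorem bval_lt (l : List Bool) : bval l < 2 ^ l.length := by
  induction l using List.reverseRecOn with
  | nil => simp [bval]
  | append_singleton l b ih =>
    rw [bval_concat, List.length_append, List.length_singleton, pow_succ]
    have := Bool.toNat_le b
    omega

theorem bval_inj : ∀ {l₁ l₂ : List Bool}, l₁.length = l₂.length → bval l₁ = bval l₂ → l₁ = l₂ := by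
  intro l₁
  induction l₁ using List.reverseRecOn with
  | nil => intro l₂ h _; simpa [eq_comm] using h
  | append_singleton l b ih =>
    intro l₂ h hv
    induction l₂ using List.reverseRecOn with
    | nil => simp at h
    | append_singleton l' b' _ =>
      rw [bval_concat, bval_concat] at hv
      simp only [List.length_append, List.length_singleton, Nat.add_right_cancel_iff] at h
      have h1 := Bool.toNat_le b
      have h2 := Bool.toNat_le b'
      have hb : b = b' := by
        have : b.toNat = b'.toNat := by omega
        cases b <;> cases b' <;> simp_all
      subst hb
      rw [ih h (by omega)]

theorem exists_bval (L : ℕ) : ∀ M < 2 ^ L, ∃ w : List Bool, w.length = L ∧ bval w = M := by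
  induction L with
  | zero => intro M hM; exact ⟨[], rfl, by simp [bval]; omega⟩
  | succ L ih =>
    intro M hM
    rw [pow_succ] at hM
    obtain ⟨w, h1, h2⟩ := ih (M / 2) (by omega)
    refine ⟨w ++ [decide (M % 2 = 1)], by simp [h1], ?_⟩
    rw [bval_concat, h2]
    rcases Nat.mod_two_eq_zero_or_one M with h | h <;> simp [h] <;> omega

theorem firstBits_length (α : ℝ) (n : ℕ) : (firstBits α n).length = n := by simp [firstBits]

theorem bval_firstBits (α : ℝ) (h0 : 0 ≤ α) (h1 : α < 1) (n : ℕ) :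
    bval (firstBits α n) = ⌊α * 2 ^ n⌋₊ := by
  induction n with
  | zero => simp [firstBits, bval]; symm; rw [Nat.floor_eq_zero]; exact h1
  | succ n ih =>
    have hs : firstBits α (n + 1) = firstBits α n ++ [bitOf α n] := by
      simp [firstBits, List.range_succ]
    rw [hs, bval_concat, ih]
    have hfl : ⌊α⌋ = 0 := Int.floor_eq_zero_iff.2 ⟨h0, h1⟩
    have hx : 0 ≤ α * 2 ^ (n + 1) := by positivity
    have hb : bitOf α n = decide (⌊α * 2 ^ (n + 1)⌋₊ % 2 = 1) := by
      unfold bitOf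
      rw [hfl]
      simp only [Int.cast_zero, sub_zero]
      rw [← Int.natCast_floor_eq_floor hx]
      apply decide_eq_decide.2
      omega
    have hd : ⌊α * 2 ^ n⌋₊ = ⌊α * 2 ^ (n + 1)⌋₊ / 2 := by
      have : α * 2 ^ n = α * 2 ^ (n + 1) / (2 : ℕ) := by push_cast; rw [pow_succ]; ring
      rw [this, Nat.floor_div_natCast]
    rw [hb, hd]
    rcases Nat.mod_two_eq_zero_or_one ⌊α * 2 ^ (n + 1)⌋₊ with h | h <;> simp [h] <;> omega

end Strings

section Coding

theorem complexity_le {U : Computer} {q s : List Bool} (h : s ∈ U.f q) :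
    complexity U s ≤ q.length := Nat.sInf_le ⟨q, h, rfl⟩

theorem optimal_use {U : Computer} (hU : Optimal U) (C : Computer) :
    ∃ d : ℕ, ∀ p s, s ∈ C.f p → ∃ q, s ∈ U.f q ∧ q.length ≤ p.length + d := by
  obtain ⟨d, hd⟩ := hU C
  refine ⟨d, fun p s hs => ?_⟩
  obtain ⟨q, h1, h2⟩ := hd p (Part.dom_iff_mem.2 ⟨s, hs⟩)
  exact ⟨q, h1 ▸ hs, h2⟩

theorem coding {U : Computer} (hU : Optimal U) {α : Type} [Primcodable α]
    (e : α → List Bool) (he : Computable e) (hinj : Function.Injective e)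
    (g : α →. List Bool) (hg : Partrec g)
    (hpf : ∀ x y, (g x).Dom → (g y).Dom → e x <+: e y → x = y) :
    ∃ d : ℕ, ∀ x s, s ∈ g x → ∃ q, s ∈ U.f q ∧ q.length ≤ (e x).length + d := by
  by_cases hne : ∃ x, (g x).Dom
  · have hc : Computable₂ fun (p : List Bool) (x : α) => decide (e x = p) :=
      (cEq (he.comp Computable.snd) Computable.fst).to₂
    obtain ⟨f, hf, h1, h2⟩ := exists_search hc
    have hfe : ∀ x, f (e x) = Part.some x := by
      intro x
      have hd := h2 (e x) x (by simp)
      obtain ⟨y, hy⟩ := Part.dom_iff_mem.1 hd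
      have := h1 _ _ hy
      rw [decide_eq_true_iff] at this
      have := hinj this
      subst this
      exact Part.eq_some_iff.2 hy
    have hdom : ∀ p, ((f p).bind g).Dom → ∃ x, e x = p ∧ (g x).Dom := by
      intro p hp
      obtain ⟨s, hs⟩ := Part.dom_iff_mem.1 hp
      obtain ⟨x, hx, hs⟩ := Part.mem_bind_iff.1 hs
      have := h1 _ _ hx
      rw [decide_eq_true_iff] at this
      exact ⟨x, this, Part.dom_iff_mem.2 ⟨s, hs⟩⟩
    let C : Computer :=
      { f := fun p => (f p).bind g
        partrec := hf.bind (hg.comp Computable.snd).to₂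
        dom_nonempty := by
          obtain ⟨x, hx⟩ := hne
          refine ⟨e x, ?_⟩
          obtain ⟨s, hs⟩ := Part.dom_iff_mem.1 hx
          exact Part.dom_iff_mem.2 ⟨s, Part.mem_bind_iff.2 ⟨x, by rw [hfe]; exact Part.mem_some x, hs⟩⟩
        dom_prefixFree := by
          intro p hp q hq hpq
          obtain ⟨x, rfl, hx⟩ := hdom p hp
          obtain ⟨y, rfl, hy⟩ := hdom q hq
          rw [hpf x y hx hy hpq] }
    obtain ⟨d, hd⟩ := optimal_use hU C
    refine ⟨d, fun x s hs => hd (e x) s ?_⟩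
    exact Part.mem_bind_iff.2 ⟨x, by rw [hfe]; exact Part.mem_some x, hs⟩
  · refine ⟨0, fun x s hs => absurd ⟨x, Part.dom_iff_mem.2 ⟨s, hs⟩⟩ hne⟩

theorem exists_program {U : Computer} (hU : Optimal U) (s : List Bool) :
    ∃ q, s ∈ U.f q ∧ q.length = complexity U s := by
  obtain ⟨d, hd⟩ := coding hU (fun _ : Unit => []) (Computable.const []) (fun _ _ _ => rfl)
    (fun _ => Part.some s) (Computable.const s) (fun _ _ _ _ _ => rfl)
  obtain ⟨q, h1, _⟩ := hd () s (by simp)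
  have : (complexity U s) ∈ {n | ∃ p : List Bool, s ∈ U.f p ∧ p.length = n} :=
    Nat.sInf_mem ⟨_, q, h1, rfl⟩
  exact this

/-- Applying a partial recursive map increases complexity by at most a constant,
also when changing the optimal computer. -/
theorem complexity_map {U V : Computer} (hU : Optimal U) (hV : Optimal V)
    (h : List Bool →. List Bool) (hh : Partrec h) :
    ∃ d : ℕ, ∀ x s, s ∈ h x → complexity V s ≤ complexity U x + d := by
  by_cases hne : ∃ x, (h x).Dom
  · let C : Computer :=
      { f := fun p => (U.f p).bind h
        partrec := U.partrec.bind (hh.comp Computable.snd).to₂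
        dom_nonempty := by
          obtain ⟨x, hx⟩ := hne
          obtain ⟨q, hq, _⟩ := exists_program hU x
          refine ⟨q, ?_⟩
          obtain ⟨s, hs⟩ := Part.dom_iff_mem.1 hx
          exact Part.dom_iff_mem.2 ⟨s, Part.mem_bind_iff.2 ⟨x, hq, hs⟩⟩
        dom_prefixFree := by
          intro p hp q hq hpq
          refine U.dom_prefixFree p ?_ q ?_ hpq
          · exact Part.Dom.of_bind hp
          · exact Part.Dom.of_bind hq }
    obtain ⟨d, hd⟩ := optimal_use hV C
    refine ⟨d, fun x s hs => ?_⟩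
    obtain ⟨q, hq, hl⟩ := exists_program hU x
    obtain ⟨r, hr, hl'⟩ := hd q s (Part.mem_bind_iff.2 ⟨x, hq, hs⟩)
    exact (complexity_le hr).trans (hl ▸ hl')
  · exact ⟨0, fun x s hs => absurd ⟨x, Part.dom_iff_mem.2 ⟨s, hs⟩⟩ hne⟩

end Coding

open Nat.Partrec (Code)
section Approx

theorem pPow : Primrec₂ ((· ^ ·) : ℕ → ℕ → ℕ) := by
  have : Primrec₂ fun a b : ℕ => Nat.rec (motive := fun _ => ℕ) 1 (fun _ y => y * a) b :=
    Primrec.nat_rec (Primrec.const 1)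
      (Primrec.nat_mul.comp (Primrec.snd.comp Primrec.snd) Primrec.fst).to₂
  refine this.of_eq fun a b => ?_
  induction b with
  | zero => simp
  | succ n ih => rw [pow_succ, ← ih]

/-- `⌊2^k * 2^(-u/v)⌋`. -/
def rt (u v k : ℕ) : ℕ := Nat.findGreatest (fun e => e ^ v * 2 ^ u ≤ 2 ^ (k * v)) (2 ^ k)

theorem comp_rt {α : Type} [Primcodable α] {u v k : α → ℕ} (hu : Computable u) (hv : Computable v)
    (hk : Computable k) : Computable fun a => rt (u a) (v a) (k a) := by
  have : Primrec fun p : (ℕ × ℕ) × ℕ => rt p.1.1 p.1.2 p.2 := by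
    refine Primrec.nat_findGreatest (p := fun (p : (ℕ × ℕ) × ℕ) e =>
      e ^ p.1.2 * 2 ^ p.1.1 ≤ 2 ^ (p.2 * p.1.2)) (pPow.comp (Primrec.const 2) Primrec.snd) ?_
    have hp : Primrec fun q : ((ℕ × ℕ) × ℕ) × ℕ => q.1.1.2 :=
      Primrec.snd.comp (Primrec.fst.comp Primrec.fst)
    exact Primrec.nat_le.comp (Primrec.nat_mul.comp (pPow.comp Primrec.snd hp)
      (pPow.comp (Primrec.const 2) (Primrec.fst.comp (Primrec.fst.comp Primrec.fst))))
      (pPow.comp (Primrec.const 2) (Primrec.nat_mul.comp (Primrec.snd.comp Primrec.fst) hp))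
  exact this.to_comp.comp ((hu.pair hv).pair hk)

theorem rt_pred {u v k e : ℕ} (hv : 0 < v) :
    e ^ v * 2 ^ u ≤ 2 ^ (k * v) ↔ (e : ℝ) ≤ 2 ^ k * (2 : ℝ) ^ (-((u : ℝ) / v)) := by
  have hv' : (v : ℝ) ≠ 0 := by exact_mod_cast hv.ne'
  have h2 : ((2 : ℝ) ^ (-((u : ℝ) / v))) ^ v = ((2 : ℝ) ^ u)⁻¹ := by
    rw [← Real.rpow_natCast, ← Real.rpow_mul (by norm_num), neg_mul, div_mul_cancel₀ _ hv',
      Real.rpow_neg (by norm_num), Real.rpow_natCast]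
  rw [← pow_le_pow_iff_left₀ (a := (e : ℝ)) (by positivity) (by positivity) hv.ne', mul_pow, h2, ← pow_mul,
    ← div_eq_mul_inv, le_div_iff₀ (by positivity)]
  exact_mod_cast Iff.rfl

theorem rt_le {u v : ℕ} (hv : 0 < v) (k : ℕ) :
    (rt u v k : ℝ) ≤ 2 ^ k * (2 : ℝ) ^ (-((u : ℝ) / v)) := by
  rw [← rt_pred hv]
  have := Nat.findGreatest_spec (P := fun e => e ^ v * 2 ^ u ≤ 2 ^ (k * v)) (n := 2 ^ k)
    (Nat.zero_le _) (by simp [hv.ne'])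
  exact this

theorem lt_rt {u v : ℕ} (hv : 0 < v) (k : ℕ) :
    2 ^ k * (2 : ℝ) ^ (-((u : ℝ) / v)) < rt u v k + 1 := by
  by_contra h
  push Not at h
  have h' : ((rt u v k + 1 : ℕ) : ℝ) ≤ 2 ^ k * (2 : ℝ) ^ (-((u : ℝ) / v)) := by
    push_cast; exact h
  have hle : rt u v k + 1 ≤ 2 ^ k := by
    have : (2 : ℝ) ^ (-((u : ℝ) / v)) ≤ 1 :=
      Real.rpow_le_one_of_one_le_of_nonpos (by norm_num) (by rw [neg_nonpos]; positivity)
    have h3 : ((rt u v k + 1 : ℕ) : ℝ) ≤ 2 ^ k := h'.trans (by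
      nlinarith [pow_pos (show (0 : ℝ) < 2 by norm_num) k])
    exact_mod_cast h3
  rw [← rt_pred hv] at h'
  exact Nat.findGreatest_is_greatest (P := fun e => e ^ v * 2 ^ u ≤ 2 ^ (k * v))
    (Nat.lt_succ_self _) hle h'

/-- Length of the string with code `i`. -/
def ln (i : ℕ) : ℕ := ((Encodable.decode (α := List Bool) i).map List.length).getD 0

theorem ln_encode (p : List Bool) : ln (Encodable.encode p) = p.length := by simp [ln]

theorem comp_ln : Computable ln :=
  Computable.option_getD (Computable.option_map Computable.decode
    (Computable.list_length.comp Computable.snd).to₂) (Computable.const 0)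

def stg (c : Code) (j : ℕ) : Finset ℕ :=
  (Finset.range j).filter fun i => (Code.evaln j c i).isSome = true

theorem comp_evaln (c : Code) {α : Type} [Primcodable α] {j i : α → ℕ} (hj : Computable j)
    (hi : Computable i) : Computable fun a => Code.evaln (j a) c (i a) :=
  Code.primrec_evaln.to_comp.comp ((hj.pair (Computable.const c)).pair hi)

def gs (c : Code) (j k a b n M : ℕ) : ℕ :=
  ∑ i ∈ Finset.range j, bif (Code.evaln j c i).isSome then
    rt ((b * ln i - a) * 2 ^ n) (b * M) k else 0

theorem comp_gs (c : Code) {α : Type} [Primcodable α] {j k a b n M : α → ℕ}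
    (hj : Computable j) (hk : Computable k) (ha : Computable a) (hb : Computable b)
    (hn : Computable n) (hM : Computable M) :
    Computable fun x => gs c (j x) (k x) (a x) (b x) (n x) (M x) := by
  have f1 : Computable (Prod.fst : α × ℕ → α) := Computable.fst
  refine cSum hj ?_
  refine (Computable.cond (c := fun p : α × ℕ => (Code.evaln (j p.1) c p.2).isSome)
    (f := fun p : α × ℕ => rt ((b p.1 * ln p.2 - a p.1) * 2 ^ n p.1) (b p.1 * M p.1) (k p.1))
    ?_ (comp_rt ?_ ?_ (hk.comp f1)) (Computable.const 0)).to₂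
  · exact Primrec.option_isSome.to_comp.comp (comp_evaln c (hj.comp f1) Computable.snd)
  · exact cMul (cSub (cMul (hb.comp f1) (comp_ln.comp Computable.snd)) (ha.comp f1))
      (cPow (Computable.const 2) (hn.comp f1))
  · exact cMul (hb.comp f1) (hM.comp f1)

noncomputable def ex (a b n M i : ℕ) : ℝ := (2 : ℝ) ^ (-((((b * ln i - a : ℕ) : ℝ) / b) / (M / 2 ^ n)))

theorem gs_eq (c : Code) (j k a b n M : ℕ) : gs c j k a b n M =
    ∑ i ∈ stg c j, rt ((b * ln i - a) * 2 ^ n) (b * M) k := by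
  rw [gs, stg, Finset.sum_filter]
  refine Finset.sum_congr rfl fun i _ => ?_
  cases (Code.evaln j c i).isSome <;> simp

theorem ex_eq (a b n M i : ℕ) :
    ex a b n M i = (2 : ℝ) ^ (-((((b * ln i - a) * 2 ^ n : ℕ) : ℝ) / ((b * M : ℕ) : ℝ))) := by
  unfold ex
  congr 2
  push_cast
  rw [div_div_eq_mul_div, div_mul_eq_mul_div, div_div]

theorem gs_le (c : Code) {b M : ℕ} (hb : 0 < b) (hM : 0 < M) (j k a n : ℕ) :
    (gs c j k a b n M : ℝ) ≤ 2 ^ k * ∑ i ∈ stg c j, ex a b n M i := by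
  rw [gs_eq, Finset.mul_sum]
  push_cast
  refine Finset.sum_le_sum fun i _ => ?_
  rw [ex_eq]
  exact rt_le (Nat.mul_pos hb hM) k

theorem le_gs (c : Code) {b M : ℕ} (hb : 0 < b) (hM : 0 < M) (j k a n : ℕ) :
    2 ^ k * ∑ i ∈ stg c j, ex a b n M i ≤ (gs c j k a b n M : ℝ) + j := by
  have h1 : ((stg c j).card : ℝ) ≤ j := by
    exact_mod_cast (Finset.card_filter_le _ _).trans (Finset.card_range j).le
  have : 2 ^ k * ∑ i ∈ stg c j, ex a b n M i ≤
      ∑ i ∈ stg c j, ((rt ((b * ln i - a) * 2 ^ n) (b * M) k : ℝ) + 1) := by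
    rw [Finset.mul_sum]
    refine Finset.sum_le_sum fun i _ => ?_
    rw [ex_eq]
    exact (lt_rt (Nat.mul_pos hb hM) k).le
  rw [Finset.sum_add_distrib] at this
  rw [gs_eq]; push_cast
  simp at this ⊢
  linarith

/-- Boltzmann weight normalised by the free energy. -/
noncomputable def wt (F t : ℝ) (i : ℕ) : ℝ := (2 : ℝ) ^ (-(((ln i : ℝ) - F) / t))

theorem cast_tsub_max (x y : ℕ) : ((x - y : ℕ) : ℝ) = max ((x : ℝ) - y) 0 := by
  rcases le_total y x with h | h
  · rw [Nat.cast_sub h, max_eq_left]; simpa using h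
  · rw [Nat.sub_eq_zero_of_le h, max_eq_right] <;> simpa using h

theorem ex_le_wt {F : ℝ} {a b n M i : ℕ} (hb : 0 < b) (ha : (a : ℝ) ≤ b * F) :
    ex a b n M i ≤ wt F (M / 2 ^ n) i := by
  unfold ex wt
  have hb' : (0 : ℝ) < b := by exact_mod_cast hb
  apply Real.rpow_le_rpow_of_exponent_le (by norm_num)
  rw [neg_le_neg_iff]
  gcongr
  rw [le_div_iff₀ hb', cast_tsub_max]
  refine le_max_of_le_left ?_
  push_cast; nlinarith

theorem wt_le_ex {F : ℝ} {a b n M i : ℕ} (hb : 0 < b) (hi : F ≤ ln i) (ha : b * F ≤ (a : ℝ)) :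
    wt F (M / 2 ^ n) i ≤ ex a b n M i := by
  unfold ex wt
  have hb' : (0 : ℝ) < b := by exact_mod_cast hb
  apply Real.rpow_le_rpow_of_exponent_le (by norm_num)
  rw [neg_le_neg_iff]
  gcongr
  rw [div_le_iff₀ hb', cast_tsub_max]
  refine max_le ?_ ?_
  · push_cast; nlinarith
  · nlinarith

open Filter Topology in
theorem gs_tendsto (c : Code) {M : ℕ} (hM : 0 < M) (n j : ℕ) {F : ℝ} (A : ℕ → ℕ)
    (hA : Tendsto (fun k : ℕ => (A k : ℝ) / (k + 1)) atTop (𝓝 F))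
    (hS : ∀ i ∈ stg c j, F ≤ ln i) :
    Tendsto (fun k => (gs c j k (A k) (k + 1) n M : ℝ) / 2 ^ k) atTop
      (𝓝 (∑ i ∈ stg c j, wt F (M / 2 ^ n) i)) := by
  have hmid : Tendsto (fun k => ∑ i ∈ stg c j, ex (A k) (k + 1) n M i) atTop
      (𝓝 (∑ i ∈ stg c j, wt F (M / 2 ^ n) i)) := by
    refine tendsto_finsetSum _ fun i hi => ?_
    unfold ex wt
    have e : ∀ k : ℕ, ((((k + 1) * ln i - A k : ℕ) : ℝ) / ((k + 1 : ℕ) : ℝ)) =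
        max ((ln i : ℝ) - (A k : ℝ) / (k + 1)) 0 := by
      intro k
      have hk : (0 : ℝ) < (k : ℝ) + 1 := by positivity
      rw [cast_tsub_max]
      push_cast
      rw [← max_div_div_right hk.le, zero_div]
      congr 1
      field_simp
    simp_rw [e]
    have hm : Tendsto (fun k : ℕ => max ((ln i : ℝ) - (A k : ℝ) / (k + 1)) 0) atTop
        (𝓝 ((ln i : ℝ) - F)) := by
      have := ((tendsto_const_nhds (x := (ln i : ℝ))).sub hA).max (tendsto_const_nhds (x := (0 : ℝ)))
      rwa [max_eq_left (by linarith [hS i hi])] at this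
    have hc : Continuous fun x : ℝ => (2 : ℝ) ^ (-(x / (M / 2 ^ n))) := by
      refine Continuous.rpow continuous_const (by fun_prop) ?_
      intro x; left; norm_num
    exact (hc.tendsto _).comp hm
  have hj : Tendsto (fun k : ℕ => (j : ℝ) / 2 ^ k) atTop (𝓝 0) := by
    have := (tendsto_pow_atTop_nhds_zero_of_lt_one (r := (1 / 2 : ℝ)) (by norm_num)
      (by norm_num)).const_mul (j : ℝ)
    simpa [div_eq_mul_inv] using this
  have hlow := hmid.sub hj
  rw [sub_zero] at hlow
  refine tendsto_of_tendsto_of_tendsto_of_le_of_le hlow hmid (fun k => ?_) (fun k => ?_)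
  · have := le_gs c (Nat.succ_pos k) hM j k (A k) n
    have h2 : (0 : ℝ) < 2 ^ k := by positivity
    rw [le_div_iff₀ h2, sub_mul, div_mul_cancel₀ _ h2.ne']
    simp only [Nat.succ_eq_add_one] at this
    linarith
  · have := gs_le c (Nat.succ_pos k) hM j k (A k) n
    have h2 : (0 : ℝ) < 2 ^ k := by positivity
    simp only [Nat.succ_eq_add_one] at this
    rw [div_le_iff₀ h2]
    linarith

end Approx

section Analysis

structure Sys (D : Set ℕ) (F T : ℝ) : Prop where
  T0 : 0 < T
  T1 : T < 1
  F0 : 0 ≤ F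
  ne : D.Nonempty
  kraft : ∀ S : Finset ℕ, (S : Set ℕ) ⊆ D → ∑ i ∈ S, (2 : ℝ) ^ (-(ln i : ℝ)) ≤ 1
  lt : ∀ i ∈ D, F < ln i
  sum_le : ∀ S : Finset ℕ, (S : Set ℕ) ⊆ D → ∑ i ∈ S, wt F T i ≤ 1
  sup : ∀ ε : ℝ, 0 < ε → ∃ S : Finset ℕ, (S : Set ℕ) ⊆ D ∧ 1 - ε < ∑ i ∈ S, wt F T i

theorem two_rpow_eq (x : ℝ) : (2 : ℝ) ^ x = Real.exp (Real.log 2 * x) :=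
  Real.rpow_def_of_pos (by norm_num) x

theorem wt_pos (F t : ℝ) (i : ℕ) : 0 < wt F t i := Real.rpow_pos_of_pos (by norm_num) _

theorem lip_aux {a T t t1 : ℝ} (ha : 0 ≤ a) (hT : 0 < T) (h1 : T ≤ t) (h2 : t ≤ t1) (h3 : t1 < 1) :
    (2 : ℝ) ^ (-(a / t)) - (2 : ℝ) ^ (-(a / T)) ≤
      (2 : ℝ) ^ (-a) * ((t - T) / ((1 / t1 - 1) * T ^ 2)) := by
  have ht : 0 < t := hT.trans_le h1
  have ht1 : 0 < t1 := ht.trans_le h2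
  have hl : 0 < Real.log 2 := Real.log_pos (by norm_num)
  set s := 1 / t1 - 1 with hs
  have hs0 : 0 < s := by rw [hs, sub_pos, lt_div_iff₀ ht1]; linarith
  set x := Real.log 2 * a with hx
  have hx0 : 0 ≤ x := by positivity
  have e1 : (2 : ℝ) ^ (-(a / t)) = Real.exp (-(x / t)) := by rw [two_rpow_eq, hx]; congr 1; ring
  have e2 : (2 : ℝ) ^ (-(a / T)) = Real.exp (-(x / T)) := by rw [two_rpow_eq, hx]; congr 1; ring
  have e3 : (2 : ℝ) ^ (-a) = Real.exp (-x) := by rw [two_rpow_eq, hx]; congr 1; ring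
  rw [e1, e2, e3]
  have hd : x / T - x / t = x * ((t - T) / (t * T)) := by field_simp
  have e4 : Real.exp (-(x / T)) = Real.exp (-(x / t)) * Real.exp (-(x * ((t - T) / (t * T)))) := by
    rw [← Real.exp_add, ← hd]; congr 1; ring
  have e5 : 1 - x * ((t - T) / (t * T)) ≤ Real.exp (-(x * ((t - T) / (t * T)))) := by
    have := Real.add_one_le_exp (-(x * ((t - T) / (t * T)))); linarith
  have e6 : Real.exp (-(x / t)) ≤ Real.exp (-x) * Real.exp (-(x * s)) := by
    rw [← Real.exp_add]
    apply Real.exp_le_exp.2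
    have : x / t1 ≤ x / t := by gcongr
    have h' : x / t1 = x + x * s := by rw [hs]; ring
    linarith
  have e7 : x * Real.exp (-(x * s)) ≤ 1 / s := by
    have h7 : x * s ≤ Real.exp (x * s) := by have := Real.add_one_le_exp (x * s); linarith
    rw [le_div_iff₀ hs0, Real.exp_neg, mul_right_comm, ← div_eq_mul_inv, div_le_one (Real.exp_pos _)]
    exact h7
  have hq : (t - T) / (t * T) ≤ (t - T) / T ^ 2 := by
    have : T ^ 2 ≤ t * T := by nlinarith
    have h0 : 0 ≤ t - T := by linarith
    gcongr
  have hq0 : 0 ≤ (t - T) / (t * T) := div_nonneg (by linarith) (by positivity)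
  calc Real.exp (-(x / t)) - Real.exp (-(x / T))
      ≤ Real.exp (-(x / t)) * (x * ((t - T) / (t * T))) := by
        rw [e4]; nlinarith [Real.exp_pos (-(x / t))]
    _ ≤ (Real.exp (-x) * Real.exp (-(x * s))) * (x * ((t - T) / (t * T))) := by
        apply mul_le_mul_of_nonneg_right e6; positivity
    _ = Real.exp (-x) * ((x * Real.exp (-(x * s))) * ((t - T) / (t * T))) := by ring
    _ ≤ Real.exp (-x) * ((1 / s) * ((t - T) / T ^ 2)) := by
        gcongr
    _ = Real.exp (-x) * ((t - T) / (s * T ^ 2)) := by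
        congr 1; field_simp

theorem grow_aux {a δ T t : ℝ} (hδ : 0 < δ) (ha : δ ≤ a) (hT : 0 < T) (h1 : T ≤ t) (h2 : t ≤ 1) :
    (2 : ℝ) ^ (-(a / T)) * (1 + Real.log 2 * δ / T * (t - T)) ≤ (2 : ℝ) ^ (-(a / t)) := by
  have ht : 0 < t := hT.trans_le h1
  have hl : 0 < Real.log 2 := Real.log_pos (by norm_num)
  have e : (2 : ℝ) ^ (-(a / t)) = (2 : ℝ) ^ (-(a / T)) * (2 : ℝ) ^ (a * ((t - T) / (t * T))) := by
    rw [← Real.rpow_add (by norm_num)]; congr 1; field_simp; ring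
  rw [e]
  apply mul_le_mul_of_nonneg_left _ (Real.rpow_pos_of_pos (by norm_num) _).le
  rw [two_rpow_eq]
  have := Real.add_one_le_exp (Real.log 2 * (a * ((t - T) / (t * T))))
  have hq : (t - T) / T ≤ (t - T) / (t * T) := by
    have h0 : 0 ≤ t - T := by linarith
    have : t * T ≤ T := by nlinarith
    gcongr
  have hq0 : 0 ≤ (t - T) / T := div_nonneg (by linarith) hT.le
  have ha0 : 0 ≤ a := hδ.le.trans ha
  have : Real.log 2 * δ / T * (t - T) ≤ Real.log 2 * (a * ((t - T) / (t * T))) := by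
    calc Real.log 2 * δ / T * (t - T) = Real.log 2 * (δ * ((t - T) / T)) := by ring
      _ ≤ _ := by gcongr
  linarith

variable {D : Set ℕ} {F T : ℝ}

theorem Sys.lip (h : Sys D F T) {t1 : ℝ} (hT : T < t1) (h1 : t1 < 1) :
    ∃ C : ℝ, 0 < C ∧ ∀ S : Finset ℕ, (S : Set ℕ) ⊆ D → ∀ t, T ≤ t → t ≤ t1 →
      ∑ i ∈ S, wt F t i ≤ ∑ i ∈ S, wt F T i + C * (t - T) := by
  have hT0 := h.T0
  have ht1 : 0 < t1 := hT0.trans hT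
  have hs0 : 0 < 1 / t1 - 1 := by rw [sub_pos, lt_div_iff₀ ht1]; linarith
  refine ⟨(2 : ℝ) ^ F / ((1 / t1 - 1) * T ^ 2), by positivity, fun S hS t h2 h3 => ?_⟩
  have hK := h.kraft S hS
  have h0 : 0 ≤ t - T := by linarith
  have : ∑ i ∈ S, (wt F t i - wt F T i) ≤
      ∑ i ∈ S, (2 : ℝ) ^ (-(ln i : ℝ)) * ((2 : ℝ) ^ F * ((t - T) / ((1 / t1 - 1) * T ^ 2))) := by
    refine Finset.sum_le_sum fun i hi => ?_
    have := lip_aux (a := ln i - F) (by linarith [h.lt i (hS hi)]) h.T0 h2 h3 h1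
    refine this.trans (le_of_eq ?_)
    rw [← mul_assoc, ← Real.rpow_add (by norm_num)]
    congr 2; ring
  rw [Finset.sum_sub_distrib, ← Finset.sum_mul] at this
  have h4 : 0 ≤ (2 : ℝ) ^ F * ((t - T) / ((1 / t1 - 1) * T ^ 2)) := by positivity
  have h5 := mul_le_mul_of_nonneg_right hK h4
  have h6 : (2 : ℝ) ^ F * ((t - T) / ((1 / t1 - 1) * T ^ 2)) =
    (2 : ℝ) ^ F / ((1 / t1 - 1) * T ^ 2) * (t - T) := by ring
  linarith

theorem Sys.gap (h : Sys D F T) : ∃ δ : ℝ, 0 < δ ∧ ∀ i ∈ D, δ ≤ ln i - F := by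
  obtain ⟨i0, hi0⟩ := h.ne
  have hne : (ln '' D).Nonempty := ⟨_, i0, hi0, rfl⟩
  obtain ⟨j, hj, hjm⟩ := Nat.sInf_mem hne
  refine ⟨ln j - F, by linarith [h.lt j hj], fun i hi => ?_⟩
  have : ln j ≤ ln i := by rw [hjm]; exact Nat.sInf_le ⟨i, hi, rfl⟩
  have : (ln j : ℝ) ≤ ln i := by exact_mod_cast this
  linarith

theorem Sys.grow (h : Sys D F T) : ∃ κ : ℝ, 0 < κ ∧ ∀ S : Finset ℕ, (S : Set ℕ) ⊆ D →
    ∀ t, T ≤ t → t ≤ 1 → (∑ i ∈ S, wt F T i) * (1 + κ * (t - T)) ≤ ∑ i ∈ S, wt F t i := by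
  obtain ⟨δ, hδ, hd⟩ := h.gap
  have hl : 0 < Real.log 2 := Real.log_pos (by norm_num)
  have hT0 := h.T0
  refine ⟨Real.log 2 * δ / T, by positivity, fun S hS t h1 h2 => ?_⟩
  rw [Finset.sum_mul]
  exact Finset.sum_le_sum fun i hi => grow_aux hδ (hd i (hS hi)) h.T0 h1 h2

theorem wt_lt {i : ℕ} {t t' : ℝ} (hi : F < ln i) (h0 : 0 < t) (h : t < t') :
    wt F t i < wt F t' i := by
  unfold wt
  apply Real.rpow_lt_rpow_of_exponent_lt (by norm_num)
  rw [neg_lt_neg_iff]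
  exact div_lt_div_of_pos_left (by linarith) h0 h

theorem Sys.sum_lt (h : Sys D F T) {S : Finset ℕ} (hS : (S : Set ℕ) ⊆ D) (hne : S.Nonempty)
    {t t' : ℝ} (h0 : 0 < t) (ht : t < t') : ∑ i ∈ S, wt F t i < ∑ i ∈ S, wt F t' i :=
  Finset.sum_lt_sum_of_nonempty hne fun i hi => wt_lt (h.lt i (hS hi)) h0 ht

theorem Sys.sum_mono (h : Sys D F T) {S : Finset ℕ} (hS : (S : Set ℕ) ⊆ D)
    {t t' : ℝ} (h0 : 0 < t) (ht : t ≤ t') : ∑ i ∈ S, wt F t i ≤ ∑ i ∈ S, wt F t' i := by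
  rcases ht.eq_or_lt with rfl | ht
  · exact le_rfl
  · exact Finset.sum_le_sum fun i hi => (wt_lt (h.lt i (hS hi)) h0 ht).le

theorem Sys.lt_of_one_lt (h : Sys D F T) {S : Finset ℕ} (hS : (S : Set ℕ) ⊆ D)
    {t : ℝ} (h0 : 0 < t) (h1 : 1 < ∑ i ∈ S, wt F t i) : T < t := by
  by_contra hc
  have := h.sum_mono hS h0 (not_lt.1 hc)
  linarith [h.sum_le S hS]

theorem Sys.missing (h : Sys D F T) {t1 : ℝ} (hT : T < t1) (h1 : t1 < 1) :
    ∃ c : ℝ, ∀ (n : ℕ) (t : ℝ) (S : Finset ℕ), (S : Set ℕ) ⊆ D → T < t → t ≤ t1 →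
      t - T ≤ (2 : ℝ) ^ (-(n : ℝ)) → 1 < ∑ i ∈ S, wt F t i → ∀ i ∈ D, i ∉ S →
        T * n - c ≤ ln i := by
  obtain ⟨C, hC, hL⟩ := h.lip hT h1
  refine ⟨T * Real.logb 2 C - F, fun n t S hS h2 h3 h4 h5 i hi hiS => ?_⟩
  have hT0 := h.T0
  have a1 := h.sum_le (insert i S) (by
    intro x hx
    rcases Finset.mem_insert.1 (Finset.mem_coe.1 hx) with rfl | hx
    · exact hi
    · exact hS hx)
  rw [Finset.sum_insert hiS] at a1
  have a2 := hL S hS t h2.le h3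
  have a3 : wt F T i ≤ C * (2 : ℝ) ^ (-(n : ℝ)) := by
    have := mul_le_mul_of_nonneg_left h4 hC.le
    linarith
  have e : C * (2 : ℝ) ^ (-(n : ℝ)) = (2 : ℝ) ^ (Real.logb 2 C + -(n : ℝ)) := by
    rw [Real.rpow_add (by norm_num), Real.rpow_logb (by norm_num) (by norm_num) hC]
  rw [e, wt, Real.rpow_le_rpow_left_iff (by norm_num)] at a3
  have : ((ln i : ℝ) - F) / T * T = ln i - F := div_mul_cancel₀ _ hT0.ne'
  nlinarith

theorem Sys.exists_gt (h : Sys D F T) {t : ℝ} (h1 : T < t) (h2 : t ≤ 1) :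
    ∃ S : Finset ℕ, (S : Set ℕ) ⊆ D ∧ 1 < ∑ i ∈ S, wt F t i := by
  obtain ⟨κ, hκ, hg⟩ := h.grow
  have hx : 0 < κ * (t - T) := mul_pos hκ (by linarith)
  set x := κ * (t - T) with hxd
  obtain ⟨S, hS, hs⟩ := h.sup (x / (1 + x)) (by positivity)
  refine ⟨S, hS, ?_⟩
  have := hg S hS t h1.le h2
  have e : (1 - x / (1 + x)) * (1 + x) = 1 := by field_simp; ring
  calc (1 : ℝ) = (1 - x / (1 + x)) * (1 + x) := e.symm
    _ < (∑ i ∈ S, wt F T i) * (1 + x) := by gcongr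
    _ ≤ _ := this

theorem Sys.tail (h : Sys D F T) {S : Finset ℕ} (hS : (S : Set ℕ) ⊆ D) {n : ℕ} {L : ℝ}
    (hL : T * n ≤ L)
    (hR : ∀ R : Finset ℕ, (R : Set ℕ) ⊆ D → Disjoint R S →
      ∑ i ∈ R, (2 : ℝ) ^ (-(ln i : ℝ)) ≤ (2 : ℝ) ^ (-L)) :
    1 - (2 : ℝ) ^ (F / T) * (2 : ℝ) ^ (-(n : ℝ)) ≤ ∑ i ∈ S, wt F T i := by
  have hT0 := h.T0
  have hT1 := h.T1
  apply le_of_forall_pos_le_add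
  intro ε hε
  obtain ⟨S', hS', hs⟩ := h.sup ε hε
  have hRD : ((S' \ S : Finset ℕ) : Set ℕ) ⊆ D := fun x hx => hS' (Finset.mem_sdiff.1 hx).1
  have hr := hR (S' \ S) hRD Finset.sdiff_disjoint
  have h1 : ∑ i ∈ S', wt F T i ≤ ∑ i ∈ S, wt F T i + ∑ i ∈ S' \ S, wt F T i := by
    rw [← Finset.sum_union Finset.disjoint_sdiff]
    apply Finset.sum_le_sum_of_subset_of_nonneg
    · intro x hx; by_cases hxS : x ∈ S <;> simp [hx, hxS]
    · intro i _ _; exact (wt_pos F T i).le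
  set X := (2 : ℝ) ^ (-L) with hX
  have hXp : 0 < X := Real.rpow_pos_of_pos (by norm_num) _
  have hp : 0 ≤ 1 / T - 1 := by rw [sub_nonneg, le_div_iff₀ hT0]; linarith
  have h2 : ∑ i ∈ S' \ S, wt F T i ≤
      ∑ i ∈ S' \ S, (2 : ℝ) ^ (-(ln i : ℝ)) * ((2 : ℝ) ^ (F / T) * X ^ (1 / T - 1)) := by
    refine Finset.sum_le_sum fun i hi => ?_
    have hx : (2 : ℝ) ^ (-(ln i : ℝ)) ≤ X :=
      (Finset.single_le_sum (f := fun i => (2 : ℝ) ^ (-(ln i : ℝ)))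
        (fun i _ => (Real.rpow_pos_of_pos (by norm_num) _).le) hi).trans hr
    have e : wt F T i = (2 : ℝ) ^ (-(ln i : ℝ)) * ((2 : ℝ) ^ (F / T) *
        ((2 : ℝ) ^ (-(ln i : ℝ))) ^ (1 / T - 1)) := by
      rw [← Real.rpow_mul (by norm_num), ← Real.rpow_add (by norm_num),
        ← Real.rpow_add (by norm_num), wt]
      congr 1
      field_simp
      ring
    rw [e]
    gcongr
  rw [← Finset.sum_mul] at h2
  have h3 : (∑ i ∈ S' \ S, (2 : ℝ) ^ (-(ln i : ℝ))) * ((2 : ℝ) ^ (F / T) * X ^ (1 / T - 1)) ≤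
      X * ((2 : ℝ) ^ (F / T) * X ^ (1 / T - 1)) :=
    mul_le_mul_of_nonneg_right hr (by positivity)
  have h4 : X * ((2 : ℝ) ^ (F / T) * X ^ (1 / T - 1)) ≤
      (2 : ℝ) ^ (F / T) * (2 : ℝ) ^ (-(n : ℝ)) := by
    have : X * X ^ (1 / T - 1) = (2 : ℝ) ^ (-(L / T)) := by
      rw [hX, ← Real.rpow_mul (by norm_num), ← Real.rpow_add (by norm_num)]
      congr 1; ring
    rw [mul_left_comm, this]
    apply mul_le_mul_of_nonneg_left _ (by positivity)
    apply Real.rpow_le_rpow_of_exponent_le (by norm_num)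
    rw [neg_le_neg_iff, le_div_iff₀ hT0]; linarith
  linarith

theorem Sys.upper (h : Sys D F T) {E : ℝ} (hE : 0 < E) :
    ∃ C : ℝ, 0 ≤ C ∧ ∀ (n : ℕ) (S : Finset ℕ) (t : ℝ), (S : Set ℕ) ⊆ D → t ≤ 1 →
      1 - E * (2 : ℝ) ^ (-(n : ℝ)) ≤ ∑ i ∈ S, wt F T i → ∑ i ∈ S, wt F t i ≤ 1 →
      t ≤ T + C * (2 : ℝ) ^ (-(n : ℝ)) := by
  obtain ⟨κ, hκ, hg⟩ := h.grow
  refine ⟨2 * E / κ + 2 * E, by positivity, fun n S t hS h1 h2 h3 => ?_⟩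
  have hT0 := h.T0
  set y := (2 : ℝ) ^ (-(n : ℝ)) with hy
  have hyp : 0 < y := Real.rpow_pos_of_pos (by norm_num) _
  have hp : 0 ≤ 2 * E / κ * y := by positivity
  have hp' : 0 < E * y := by positivity
  rcases le_total t T with htT | htT
  · nlinarith
  · rcases le_total (E * y) (1 / 2) with he | he
    · have a1 := hg S hS t htT h1
      have hk : 0 ≤ κ * (t - T) := mul_nonneg hκ.le (by linarith)
      have a2 : (1 - E * y) * (1 + κ * (t - T)) ≤ 1 :=
        (mul_le_mul_of_nonneg_right h2 (by linarith)).trans (a1.trans h3)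
      have a3 : κ * (t - T) ≤ 2 * (E * y) := by nlinarith
      have a4 : t - T ≤ 2 * E / κ * y := by
        rw [div_mul_eq_mul_div, le_div_iff₀ hκ]; linarith
      nlinarith
    · nlinarith

theorem Sys.exists_m (h : Sys D F T) {E : ℝ} (hE : 0 < E) :
    ∃ n0 : ℕ, ∀ (n : ℕ), n0 ≤ n → ∀ (S : Finset ℕ), (S : Set ℕ) ⊆ D →
      1 - E * (2 : ℝ) ^ (-(n : ℝ)) ≤ ∑ i ∈ S, wt F T i →
      ∃ m : ℕ, m < 2 ^ n ∧ ∑ i ∈ S, wt F (((m + 1 : ℕ) : ℝ) / 2 ^ n) i < 1 ∧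
        1 < ∑ i ∈ S, wt F (((m + 3 : ℕ) : ℝ) / 2 ^ n) i := by
  obtain ⟨κ, hκ, hg⟩ := h.grow
  have hT0 := h.T0
  have hT1 := h.T1
  set x := κ * (1 - T) with hxd
  have hx : 0 < x := mul_pos hκ (by linarith)
  obtain ⟨n0, hn0⟩ : ∃ n0 : ℕ, (1 / 2 : ℝ) ^ n0 < min (T) (x / (1 + x) / E) :=
    exists_pow_lt_of_lt_one (by positivity) (by norm_num)
  refine ⟨n0 + 1, fun n hn S hS h2 => ?_⟩
  have hpn : (1 / 2 : ℝ) ^ n ≤ (1 / 2 : ℝ) ^ n0 :=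
    pow_le_pow_of_le_one (by norm_num) (by norm_num) (by omega)
  have hy : (2 : ℝ) ^ (-(n : ℝ)) = (1 / 2 : ℝ) ^ n := by
    rw [Real.rpow_neg (by norm_num), Real.rpow_natCast, one_div, inv_pow]
  rw [hy] at h2
  have hTn : (1 / 2 : ℝ) ^ n < T := hpn.trans_lt (hn0.trans_le (min_le_left _ _))
  have hEn : E * (1 / 2 : ℝ) ^ n < x / (1 + x) := by
    have := hpn.trans_lt (hn0.trans_le (min_le_right _ _))
    rw [lt_div_iff₀ hE] at this; linarith
  have hx1 : x / (1 + x) < 1 := by rw [div_lt_one (by positivity)]; linarith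
  have hSne : S.Nonempty := by
    by_contra hc
    rw [Finset.not_nonempty_iff_eq_empty] at hc
    rw [hc, Finset.sum_empty] at h2
    linarith
  have h2n : (0 : ℝ) < 2 ^ n := by positivity
  have hone : 1 ≤ ∑ i ∈ S, wt F 1 i := by
    have := hg S hS 1 hT1.le le_rfl
    have e : (1 - x / (1 + x)) * (1 + x) = 1 := by field_simp; ring
    calc (1 : ℝ) = (1 - x / (1 + x)) * (1 + x) := e.symm
      _ ≤ (∑ i ∈ S, wt F T i) * (1 + x) := by
        apply mul_le_mul_of_nonneg_right _ (by positivity); linarith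
      _ ≤ _ := this
  have h2le : 2 ≤ 2 ^ n := by
    calc 2 = 2 ^ 1 := rfl
      _ ≤ 2 ^ n := Nat.pow_le_pow_right (by norm_num) (by omega)
  have hex : ∃ m : ℕ, 1 ≤ ∑ i ∈ S, wt F (((m + 2 : ℕ) : ℝ) / 2 ^ n) i := by
    refine ⟨2 ^ n - 2, ?_⟩
    rw [Nat.sub_add_cancel h2le]
    push_cast
    rw [div_self h2n.ne']; exact hone
  classical
  refine ⟨Nat.find hex, ?_, ?_, ?_⟩
  · have : Nat.find hex ≤ 2 ^ n - 2 := by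
      apply Nat.find_min'
      rw [Nat.sub_add_cancel h2le]
      push_cast
      rw [div_self h2n.ne']; exact hone
    omega
  · rcases Nat.eq_zero_or_pos (Nat.find hex) with h0 | h0
    · rw [h0]
      have : ((0 + 1 : ℕ) : ℝ) / 2 ^ n = (1 / 2 : ℝ) ^ n := by simp
      rw [this]
      exact (h.sum_lt hS hSne (by positivity) hTn).trans_le (h.sum_le S hS)
    · have := Nat.find_min hex (m := Nat.find hex - 1) (by omega)
      rw [not_le] at this
      have e : Nat.find hex - 1 + 2 = Nat.find hex + 1 := by omega
      rwa [e] at this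
  · refine (Nat.find_spec hex).trans_lt (h.sum_lt hS hSne (by positivity) ?_)
    gcongr
    omega

end Analysis

section Bridge
open Nat.Partrec (Code)

/-- Codes of the programs in the domain of `V`. -/
def DV (V : Computer) : Set ℕ := {i | ∃ p ∈ V.f.Dom, Encodable.encode p = i}

theorem exists_stage_code (V : Computer) : ∃ c : Code,
    (∀ j, (stg c j : Set ℕ) ⊆ DV V) ∧
    (∀ S : Finset ℕ, (S : Set ℕ) ⊆ DV V → ∃ j, S ⊆ stg c j) ∧
    (∀ j p s, Encodable.encode p ∈ stg c j → s ∈ V.f p →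
      Code.evaln j c (Encodable.encode p) = some (Encodable.encode s)) := by
  obtain ⟨c, hc⟩ := Code.exists_code.1 (Partrec.bind_decode₂_iff.1 V.partrec)
  have key : ∀ i x, x ∈ Code.eval c i ↔ ∃ p s, Encodable.encode p = i ∧ s ∈ V.f p ∧ Encodable.encode s = x := by
    intro i x
    rw [hc]
    simp only [Part.mem_bind_iff, Part.mem_map_iff, Part.mem_coe, Option.mem_def]
    constructor
    · rintro ⟨p, hp, s, hs, rfl⟩
      exact ⟨p, s, Encodable.mem_decode₂.1 hp, hs, rfl⟩
    · rintro ⟨p, s, rfl, hs, rfl⟩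
      exact ⟨p, by simp, s, hs, rfl⟩
  refine ⟨c, fun j i hi => ?_, fun S => ?_, fun j p s hi hs => ?_⟩
  · have hi := (Finset.mem_filter.1 hi).2
    obtain ⟨x, hx⟩ := Option.isSome_iff_exists.1 hi
    obtain ⟨p, s, h1, h2, -⟩ := (key i x).1 (Code.evaln_sound hx)
    exact ⟨p, Part.dom_iff_mem.2 ⟨s, h2⟩, h1⟩
  · induction S using Finset.induction_on with
    | empty => exact fun _ => ⟨0, by simp⟩
    | insert a S ha ih =>
      intro h
      rw [Finset.coe_insert, Set.insert_subset_iff] at h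
      obtain ⟨j, hj⟩ := ih h.2
      obtain ⟨p, hp, rfl⟩ := h.1
      obtain ⟨s, hs⟩ := Part.dom_iff_mem.1 hp
      obtain ⟨k, hk⟩ := Code.evaln_complete.1 ((key _ _).2 ⟨p, s, rfl, hs, rfl⟩)
      have mem : ∀ {k' i x}, x ∈ Code.evaln k' c i → k' ≤ max j k → i ∈ stg c (max j k) := by
        intro k' i x hx hle
        have := Code.evaln_mono hle hx
        exact Finset.mem_filter.2 ⟨Finset.mem_range.2 (Code.evaln_bound this),
          Option.isSome_iff_exists.2 ⟨x, this⟩⟩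
      refine ⟨max j k, Finset.insert_subset (mem hk (le_max_right _ _)) fun i hi => ?_⟩
      obtain ⟨x, hx⟩ := Option.isSome_iff_exists.1 (Finset.mem_filter.1 (hj hi)).2
      exact mem hx (le_max_left _ _)
  · obtain ⟨x, hx⟩ := Option.isSome_iff_exists.1 (Finset.mem_filter.1 hi).2
    obtain ⟨p', s', h1, h2, h3⟩ := (key _ _).1 (Code.evaln_sound hx)
    have := Encodable.encode_injective h1
    subst this
    rw [hx, ← h3, Part.mem_unique hs h2]

theorem two_programs {V : Computer} (hV : Optimal V) :
    ∃ p ∈ V.f.Dom, ∃ q ∈ V.f.Dom, p ≠ q := by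
  obtain ⟨p, hp, -⟩ := exists_program hV []
  obtain ⟨q, hq, -⟩ := exists_program hV [true]
  refine ⟨p, Part.dom_iff_mem.2 ⟨_, hp⟩, q, Part.dom_iff_mem.2 ⟨_, hq⟩, ?_⟩
  rintro rfl
  have := Part.mem_unique hp hq
  simp at this

theorem nil_notMem {V : Computer} (hV : Optimal V) : [] ∉ V.f.Dom := by
  intro h
  obtain ⟨p, hp, q, hq, hne⟩ := two_programs hV
  have h1 := V.dom_prefixFree _ h _ hp (List.nil_prefix)
  have h2 := V.dom_prefixFree _ h _ hq (List.nil_prefix)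
  exact hne (h1.symm.trans h2)

theorem prefixFree_ud {S : Set (List Bool)} (h : PrefixFree S) (hn : [] ∉ S) :
    InformationTheory.UniquelyDecodable S := by
  intro L1
  induction L1 with
  | nil =>
    intro L2 _ h2 he
    cases L2 with
    | nil => rfl
    | cons b L2 =>
      simp at he
      exact absurd (he.1 ▸ h2 b (by simp)) hn
  | cons a L1 ih =>
    intro L2 h1 h2 he
    cases L2 with
    | nil =>
      simp at he
      exact absurd (he.1 ▸ h1 a (by simp)) hn
    | cons b L2 =>
      simp only [List.flatten_cons] at he
      have ha := h1 a (by simp)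
      have hb := h2 b (by simp)
      have hab : a = b := by
        have p1 : a <+: b ++ L2.flatten := ⟨_, he⟩
        have p2 : b <+: b ++ L2.flatten := ⟨_, rfl⟩
        rcases List.prefix_or_prefix_of_prefix p1 p2 with q | q
        · exact h _ ha _ hb q
        · exact (h _ hb _ ha q).symm
      subst hab
      rw [ih L2 (fun w hw => h1 w (by simp [hw])) (fun w hw => h2 w (by simp [hw]))
        (List.append_cancel_left he)]

theorem kraft_dom {V : Computer} (hV : Optimal V) (S : Finset V.f.Dom) :
    ∑ p ∈ S, (2 : ℝ) ^ (-(p.1.length : ℝ)) ≤ 1 := by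
  have hud : InformationTheory.UniquelyDecodable
      ((S.map (Function.Embedding.subtype _) : Finset (List Bool)) : Set (List Bool)) := by
    apply prefixFree_ud
    · intro p hp q hq
      simp at hp hq
      exact V.dom_prefixFree p (Part.dom_iff_mem.2 hp.1) q (Part.dom_iff_mem.2 hq.1)
    · intro h
      simp at h
      exact nil_notMem hV (Part.dom_iff_mem.2 h.1)
  have := InformationTheory.kraft_mcmillan_inequality hud
  rw [Finset.sum_map] at this
  refine le_trans (le_of_eq (Finset.sum_congr rfl fun p _ => ?_)) this
  simp [Real.rpow_neg]

theorem boltz_le {T : ℝ} (h0 : 0 < T) (h1 : T < 1) (p : List Bool) :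
    boltzmann T p ≤ (2 : ℝ) ^ (-(p.length : ℝ)) := by
  unfold boltzmann
  apply Real.rpow_le_rpow_of_exponent_le (by norm_num)
  rw [div_le_iff₀ h0]
  have : (0 : ℝ) ≤ p.length := by positivity
  nlinarith

theorem boltz_pos (T : ℝ) (p : List Bool) : 0 < boltzmann T p :=
  Real.rpow_pos_of_pos (by norm_num) _

theorem sys_of {V : Computer} (hV : Optimal V) {T : ℝ} (h0 : 0 < T) (h1 : T < 1) :
    Sys (DV V) (Ffun V T) T := by
  have hsumm : Summable fun p : V.f.Dom => boltzmann T p.1 :=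
    summable_of_sum_le (fun p => (boltz_pos T p.1).le) (fun S =>
      (Finset.sum_le_sum fun p _ => boltz_le h0 h1 p.1).trans (kraft_dom hV S))
  have hZ1 : Zfun V T ≤ 1 := hsumm.tsum_le_of_sum_le fun S =>
      (Finset.sum_le_sum fun p _ => boltz_le h0 h1 p.1).trans (kraft_dom hV S)
  obtain ⟨p0, hp0⟩ := V.dom_nonempty
  have hZ0 : 0 < Zfun V T :=
    hsumm.tsum_pos (fun p => (boltz_pos T p.1).le) ⟨p0, hp0⟩ (boltz_pos T p0)
  set F := Ffun V T with hFd
  have hF0 : 0 ≤ F := by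
    rw [hFd]; unfold Ffun
    have : Real.logb 2 (Zfun V T) ≤ 0 := Real.logb_nonpos (by norm_num) hZ0.le hZ1
    nlinarith
  have hFT : (2 : ℝ) ^ (F / T) = (Zfun V T)⁻¹ := by
    have : F / T = -Real.logb 2 (Zfun V T) := by
      rw [hFd]; unfold Ffun; field_simp
    rw [this, Real.rpow_neg (by norm_num), Real.rpow_logb (by norm_num) (by norm_num) hZ0]
  let g : V.f.Dom → ℕ := fun p => Encodable.encode p.1
  have hg : Function.Injective g := fun p q h => Subtype.ext (Encodable.encode_injective h)
  have hgln : ∀ p, ln (g p) = p.1.length := fun p => ln_encode _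
  have hwt : ∀ p, wt F T (g p) = boltzmann T p.1 * (Zfun V T)⁻¹ := by
    intro p
    unfold wt boltzmann
    rw [hgln, ← hFT, ← Real.rpow_add (by norm_num)]
    congr 1; ring
  have hs : HasSum (fun p => wt F T (g p)) 1 := by
    have := hsumm.hasSum.mul_right (Zfun V T)⁻¹
    simp only [← hwt] at this
    rwa [show (∑' p : V.f.Dom, boltzmann T p.1) * (Zfun V T)⁻¹ = 1 from mul_inv_cancel₀ hZ0.ne'] at this
  have tr : ∀ (φ : ℕ → ℝ) (S : Finset ℕ), (S : Set ℕ) ⊆ DV V →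
      ∑ i ∈ S, φ i = ∑ p ∈ S.preimage g hg.injOn, φ (g p) := by
    intro φ S hS
    rw [Finset.sum_preimage]
    intro x hx hx'
    obtain ⟨p, hp, h⟩ := hS hx
    exact absurd ⟨⟨p, hp⟩, h⟩ hx'
  have hle : ∀ S : Finset ℕ, (S : Set ℕ) ⊆ DV V → ∑ i ∈ S, wt F T i ≤ 1 := by
    intro S hS
    rw [tr _ S hS]
    exact sum_le_hasSum _ (fun p _ => (wt_pos _ _ _).le) hs
  refine ⟨h0, h1, hF0, ⟨_, p0, hp0, rfl⟩, fun S hS => ?_, ?_, hle, fun ε hε => ?_⟩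
  · rw [tr _ S hS]
    simp only [hgln]
    exact kraft_dom hV _
  · have hne : ∃ i ∈ DV V, ∃ j ∈ DV V, i ≠ j := by
      obtain ⟨p, hp, q, hq, hpq⟩ := two_programs hV
      exact ⟨_, ⟨p, hp, rfl⟩, _, ⟨q, hq, rfl⟩, fun h => hpq (Encodable.encode_injective h)⟩
    intro i hi
    obtain ⟨j, hj, hij⟩ : ∃ j ∈ DV V, i ≠ j := by
      obtain ⟨a, ha, b, hb, hab⟩ := hne
      by_cases h : i = a
      · exact ⟨b, hb, h ▸ hab⟩
      · exact ⟨a, ha, h⟩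
    have := hle {i, j} (by
      intro x hx; simp at hx; rcases hx with rfl | rfl <;> assumption)
    rw [Finset.sum_pair hij] at this
    have h3 : wt F T i < 1 := by linarith [wt_pos F T j]
    by_contra hc
    have : 1 ≤ wt F T i := by
      unfold wt
      apply Real.one_le_rpow (by norm_num)
      rw [neg_nonneg]
      exact div_nonpos_of_nonpos_of_nonneg (by linarith) h0.le
    linarith
  · have := hs.eventually (lt_mem_nhds (show 1 - ε < 1 by linarith))
    obtain ⟨S, hS⟩ := this.exists
    refine ⟨S.map ⟨g, hg⟩, ?_, by rw [Finset.sum_map]; exact hS⟩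
    intro i hi
    simp at hi
    obtain ⟨p, hp, -, rfl⟩ := hi
    exact ⟨p, Part.dom_iff_mem.2 hp, rfl⟩

end Bridge

section PartOne
open Nat.Partrec (Code)
open Filter Topology

/-- Length of the output of the program with code `i`, as seen at stage `j`. -/
def olen (c : Code) (j i : ℕ) : ℕ :=
  (((Code.evaln j c i).bind (Encodable.decode (α := List Bool))).map List.length).getD 0

theorem comp_olen (c : Code) : Computable₂ (olen c) := by
  have h1 : Computable fun a : ℕ × ℕ => Code.evaln a.1 c a.2 :=
    comp_evaln c Computable.fst Computable.snd
  have h2 : Computable fun a : ℕ × ℕ =>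
      (Code.evaln a.1 c a.2).bind (Encodable.decode (α := List Bool)) :=
    Computable.option_bind h1 (Computable.decode.comp Computable.snd).to₂
  exact (Computable.option_getD (Computable.option_map h2
    (Computable.list_length.comp Computable.snd).to₂) (Computable.const 0)).to₂

/-- A string longer than all outputs at stage `j`. -/
def longOut (c : Code) (j : ℕ) : List Bool :=
  (List.range (1 + ∑ i ∈ Finset.range j, olen c j i)).map fun _ => true

theorem comp_longOut (c : Code) : Computable (longOut c) := by
  have h1 : Computable fun j : ℕ => 1 + ∑ i ∈ Finset.range j, olen c j i :=
    cAdd (Computable.const 1) (cSum Computable.id (comp_olen c))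
  have h2 : Primrec fun n : ℕ => (List.range n).map fun _ => true :=
    Primrec.list_map Primrec.list_range (Primrec.const true).to₂
  exact h2.to_comp.comp h1

theorem tendsto_of_approx {A : ℕ → ℕ} {F : ℝ}
    (hA : ∀ k : ℕ, (A k : ℝ) ≤ (k + 1) * F ∧ (k + 1) * F ≤ A k + 3) :
    Tendsto (fun k : ℕ => (A k : ℝ) / (k + 1)) atTop (𝓝 F) ∧
    Tendsto (fun k : ℕ => ((A k + 3 : ℕ) : ℝ) / (k + 1)) atTop (𝓝 F) := by
  have h3 : Tendsto (fun k : ℕ => (3 : ℝ) * (1 / ((k : ℝ) + 1))) atTop (𝓝 0) := by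
    simpa using (tendsto_one_div_add_atTop_nhds_zero_nat (𝕜 := ℝ)).const_mul 3
  have hl : Tendsto (fun k : ℕ => F - (3 : ℝ) * (1 / ((k : ℝ) + 1))) atTop (𝓝 F) := by
    simpa using tendsto_const_nhds.sub h3
  have h1 : Tendsto (fun k : ℕ => (A k : ℝ) / (k + 1)) atTop (𝓝 F) := by
    refine tendsto_of_tendsto_of_tendsto_of_le_of_le hl tendsto_const_nhds (fun k => ?_) fun k => ?_
    · have hk : (0 : ℝ) < k + 1 := by positivity
      show F - 3 * (1 / ((k : ℝ) + 1)) ≤ (A k : ℝ) / (k + 1)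
      rw [le_div_iff₀ hk]
      have : (F - 3 * (1 / ((k : ℝ) + 1))) * (k + 1) = (k + 1) * F - 3 := by field_simp
      linarith [(hA k).2]
    · have hk : (0 : ℝ) < k + 1 := by positivity
      show (A k : ℝ) / (k + 1) ≤ F
      rw [div_le_iff₀ hk]
      linarith [(hA k).1]
  refine ⟨h1, ?_⟩
  have := h1.add h3
  rw [add_zero] at this
  refine this.congr fun k => ?_
  push_cast; ring

theorem part_one {U V : Computer} (hU : Optimal U) (hV : Optimal V) {T : ℝ} (h0 : 0 < T) (h1 : T < 1)
    (hF : ComputableReal (Ffun V T)) : WeaklyChaitinTRandom U T T := by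
  have hS := sys_of hV h0 h1
  obtain ⟨c, hc1, hc2, hc3⟩ := exists_stage_code V
  obtain ⟨A, hAc, hA⟩ := exists_nat_approx hS.F0 hF
  set F := Ffun V T
  let chk : List Bool → ℕ × ℕ → Bool := fun x jk =>
    decide (2 ^ jk.2 < gs c jk.1 jk.2 (A jk.2) (jk.2 + 1) x.length (bval x + 1))
  have hchk : Computable₂ chk := by
    have hj : Computable fun a : List Bool × (ℕ × ℕ) => a.2.1 := Computable.fst.comp Computable.snd
    have hk : Computable fun a : List Bool × (ℕ × ℕ) => a.2.2 := Computable.snd.comp Computable.snd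
    have hx : Computable fun a : List Bool × (ℕ × ℕ) => a.1 := Computable.fst
    exact (cLt (cPow (Computable.const 2) hk) (comp_gs c hj hk (hAc.comp hk)
      (cAdd hk (Computable.const 1)) (Computable.list_length.comp hx)
      (cAdd (comp_bval.comp hx) (Computable.const 1)))).to₂
  obtain ⟨f, hfp, hf1, hf2⟩ := exists_search hchk
  let h : List Bool →. List Bool := fun x => (f x).map fun jk => longOut c jk.1
  have hh : Partrec h := hfp.map ((comp_longOut c).comp (Computable.fst.comp Computable.snd)).to₂
  obtain ⟨d, hd⟩ := complexity_map hU hV h hh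
  set t1 := (1 + T) / 2 with ht1
  obtain ⟨c1, hm⟩ := hS.missing (t1 := t1) (by linarith) (by linarith)
  obtain ⟨n0, hn0⟩ : ∃ n0 : ℕ, ∀ n ≥ n0, T + ((2 : ℝ) ^ n)⁻¹ ≤ t1 := by
    have : Tendsto (fun n : ℕ => ((2 : ℝ) ^ n)⁻¹) atTop (𝓝 0) := by
      simpa using tendsto_pow_atTop_nhds_zero_of_lt_one (r := (2 : ℝ)⁻¹) (by norm_num) (by norm_num)
    have := this.eventually (gt_mem_nhds (show (0 : ℝ) < t1 - T by linarith))
    obtain ⟨n0, hn0⟩ := eventually_atTop.1 this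
    exact ⟨n0, fun n hn => by linarith [hn0 n hn]⟩
  refine ⟨n0 + d + ⌈|c1|⌉₊, fun n hn => ?_⟩
  push_cast
  have hc1' : c1 ≤ (⌈|c1|⌉₊ : ℝ) := (le_abs_self c1).trans (Nat.le_ceil _)
  by_cases hnn : n < n0
  · have a1 : (n : ℝ) ≤ n0 := by exact_mod_cast hnn.le
    have a2 : T * n ≤ n := by
      have : (0 : ℝ) ≤ n := by positivity
      nlinarith
    have a3 : (0 : ℝ) ≤ complexity U (firstBits T n) := by positivity
    have a4 : (0 : ℝ) ≤ d := by positivity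
    have a5 : (0 : ℝ) ≤ ⌈|c1|⌉₊ := by positivity
    linarith
  · push Not at hnn
    set x := firstBits T n with hx
    have hxl : x.length = n := firstBits_length _ _
    have hxb : bval x = ⌊T * 2 ^ n⌋₊ := bval_firstBits T h0.le h1 n
    have h2n : (0 : ℝ) < 2 ^ n := by positivity
    set t : ℝ := ((bval x + 1 : ℕ) : ℝ) / 2 ^ n with ht
    have hTt : T < t := by
      rw [ht, lt_div_iff₀ h2n, hxb]; push_cast; exact Nat.lt_floor_add_one _
    have htT : t ≤ T + ((2 : ℝ) ^ n)⁻¹ := by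
      have := Nat.floor_le (show 0 ≤ T * 2 ^ n by positivity)
      rw [ht, div_le_iff₀ h2n, hxb, add_mul, inv_mul_cancel₀ h2n.ne']; push_cast; linarith
    have ht1' : t ≤ t1 := htT.trans (hn0 n hnn)
    have hdom : (f x).Dom := by
      obtain ⟨S, hSD, hS1⟩ := hS.exists_gt hTt (by linarith)
      obtain ⟨j, hj⟩ := hc2 S hSD
      have hS2 : 1 < ∑ i ∈ stg c j, wt F t i :=
        hS1.trans_le (Finset.sum_le_sum_of_subset_of_nonneg hj fun i _ _ => (wt_pos _ _ _).le)
      have lim := gs_tendsto c (M := bval x + 1) (by omega) n j A (tendsto_of_approx hA).1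
        (fun i hi => (hS.lt i (hc1 j hi)).le)
      obtain ⟨k, hk⟩ := (lim.eventually (lt_mem_nhds hS2)).exists
      apply hf2 x (j, k)
      rw [lt_div_iff₀ (by positivity), one_mul] at hk
      simp only [chk, hxl, decide_eq_true_eq]
      exact_mod_cast hk
    obtain ⟨⟨j, k⟩, hjk⟩ := Part.dom_iff_mem.1 hdom
    have hch := hf1 _ _ hjk
    simp only [chk, hxl, decide_eq_true_eq] at hch
    have hsum : 1 < ∑ i ∈ stg c j, wt F t i := by
      have a1 := gs_le c (b := k + 1) (M := bval x + 1) (by omega) (by omega) j k (A k) n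
      have a2 : ((2 : ℝ) ^ k) < gs c j k (A k) (k + 1) n (bval x + 1) := by exact_mod_cast hch
      have a3 : ∑ i ∈ stg c j, ex (A k) (k + 1) n (bval x + 1) i ≤ ∑ i ∈ stg c j, wt F t i :=
        Finset.sum_le_sum fun i _ => ex_le_wt (by omega) (by push_cast; exact (hA k).1)
      have a4 : (0 : ℝ) < 2 ^ k := by positivity
      nlinarith
    have hs : longOut c j ∈ h x := Part.mem_map_iff _ |>.2 ⟨(j, k), hjk, rfl⟩
    have hcx := hd x _ hs
    obtain ⟨p, hp, hpl⟩ := exists_program hV (longOut c j)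
    have hpn : Encodable.encode p ∉ stg c j := by
      intro hmem
      have e1 := hc3 j p _ hmem hp
      have e2 : olen c j (Encodable.encode p) = (longOut c j).length := by
        simp [olen, e1]
      have e3 : olen c j (Encodable.encode p) ≤ ∑ i ∈ Finset.range j, olen c j i :=
        Finset.single_le_sum (f := fun i => olen c j i) (fun _ _ => Nat.zero_le _)
          (Finset.mem_filter.1 hmem).1
      rw [e2] at e3
      simp [longOut] at e3
    have fin := hm n t (stg c j) (hc1 j) hTt ht1'
      (by rw [Real.rpow_neg (by norm_num), Real.rpow_natCast]; linarith) hsum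
      (Encodable.encode p) ⟨p, Part.dom_iff_mem.2 ⟨_, hp⟩, rfl⟩ hpn
    rw [ln_encode, hpl] at fin
    have b1 : (complexity V (longOut c j) : ℝ) ≤ complexity U x + d := by exact_mod_cast hcx
    have b2 : (0 : ℝ) ≤ n0 := by positivity
    linarith

end PartOne

section PartTwo
open Nat.Partrec (Code)
open Filter Topology

/-- Unary self-delimiting code. -/
def un (k : ℕ) : List Bool := List.replicate k true ++ [false]

theorem un_length (k : ℕ) : (un k).length = k + 1 := by simp [un]

theorem comp_un : Computable un := by
  have h2 : Primrec fun n : ℕ => ((List.range n).map fun _ => true) ++ [false] :=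
    Primrec.list_append.comp (Primrec.list_map Primrec.list_range (Primrec.const true).to₂)
      (Primrec.const [false])
  refine h2.to_comp.of_eq fun n => ?_
  simp [un]

theorem un_pfx_eq : ∀ {a b : ℕ} {s t : List Bool}, un a ++ s <+: un b ++ t → a = b ∧ s <+: t
  | 0, 0, s, t, h => by simpa [un] using h
  | 0, b + 1, s, t, h => by simp [un, List.replicate_succ] at h
  | a + 1, 0, s, t, h => by simp [un, List.replicate_succ] at h
  | a + 1, b + 1, s, t, h => by
    have : un a ++ s <+: un b ++ t := by
      simpa [un, List.replicate_succ] using h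
    have := un_pfx_eq this
    exact ⟨by omega, this.2⟩

theorem ex_kraft (i : ℕ) : ex 0 1 0 1 i = (2 : ℝ) ^ (-(ln i : ℝ)) := by
  simp [ex]

theorem Sys.exists_M {D : Set ℕ} {F T : ℝ} (h : Sys D F T) (L : ℕ) : ∃ M : ℕ, M < 2 ^ L ∧
    (∀ R : Finset ℕ, (R : Set ℕ) ⊆ D → (∑ i ∈ R, (2 : ℝ) ^ (-(ln i : ℝ))) * 2 ^ L ≤ M + 1) ∧
    ∃ S : Finset ℕ, (S : Set ℕ) ⊆ D ∧ (M : ℝ) < (∑ i ∈ S, (2 : ℝ) ^ (-(ln i : ℝ))) * 2 ^ L := by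
  classical
  have hp : (0 : ℝ) < 2 ^ L := by positivity
  let P : ℕ → Prop := fun M => ∀ R : Finset ℕ, (R : Set ℕ) ⊆ D →
    (∑ i ∈ R, (2 : ℝ) ^ (-(ln i : ℝ))) * 2 ^ L ≤ M + 1
  have hlast : P (2 ^ L - 1) := by
    intro R hR
    have : (((2 ^ L - 1 : ℕ) : ℝ) + 1) = 2 ^ L := by
      have : 2 ^ L - 1 + 1 = 2 ^ L := Nat.sub_add_cancel Nat.one_le_two_pow
      exact_mod_cast this
    rw [this]
    nlinarith [h.kraft R hR]
  have hex : ∃ M, P M := ⟨_, hlast⟩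
  refine ⟨Nat.find hex, ?_, Nat.find_spec hex, ?_⟩
  · have := Nat.find_min' hex hlast
    have : 0 < 2 ^ L := by positivity
    omega
  · rcases Nat.eq_zero_or_pos (Nat.find hex) with h0 | h0
    · rw [h0]
      obtain ⟨i, hi⟩ := h.ne
      refine ⟨{i}, by simpa using hi, ?_⟩
      rw [Finset.sum_singleton, Nat.cast_zero]
      positivity
    · have := Nat.find_min hex (show Nat.find hex - 1 < Nat.find hex by omega)
      by_contra hc
      refine this fun R hR => ?_
      by_contra hlt
      refine hc ⟨R, hR, ?_⟩
      have e : ((Nat.find hex - 1 : ℕ) : ℝ) = (Nat.find hex : ℝ) - 1 := Nat.cast_pred h0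
      rw [e, sub_add_cancel] at hlt
      exact not_le.1 hlt

/-- The decidable test used by the decoder. -/
def chk1 (c : Code) (A : ℕ → ℕ) (y : (ℕ × ℕ × ℕ) × List Bool) (z : (ℕ × ℕ) × (ℕ × ℕ)) : Bool :=
  decide (y.2.length = y.1.1 * y.1.2.1) &&
  (decide (bval y.2 * 2 ^ z.1.2 < gs c z.1.1 z.1.2 0 1 0 1 * 2 ^ y.2.length) &&
  (decide (z.2.1 < 2 ^ (y.1.1 * y.1.1 + y.1.2.2)) &&
  (decide (gs c z.1.1 z.2.2 (A z.2.2 + 3) (z.2.2 + 1) (y.1.1 * y.1.1 + y.1.2.2) (z.2.1 + 1) + z.1.1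
      ≤ 2 ^ z.2.2) &&
  decide (2 ^ z.2.2 <
    gs c z.1.1 z.2.2 (A z.2.2) (z.2.2 + 1) (y.1.1 * y.1.1 + y.1.2.2) (z.2.1 + 3)))))

theorem comp_chk1 (c : Code) {A : ℕ → ℕ} (hA : Computable A) : Computable₂ (chk1 c A) := by
  have hy : Computable fun a : ((ℕ × ℕ × ℕ) × List Bool) × ((ℕ × ℕ) × (ℕ × ℕ)) => a.1 :=
    Computable.fst
  have hz : Computable fun a : ((ℕ × ℕ × ℕ) × List Bool) × ((ℕ × ℕ) × (ℕ × ℕ)) => a.2 :=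
    Computable.snd
  have hw := Computable.snd.comp hy
  have hN := Computable.fst.comp (Computable.fst.comp hy)
  have hl := Computable.fst.comp (Computable.snd.comp (Computable.fst.comp hy))
  have hr := Computable.snd.comp (Computable.snd.comp (Computable.fst.comp hy))
  have hj := Computable.fst.comp (Computable.fst.comp hz)
  have hB := Computable.snd.comp (Computable.fst.comp hz)
  have hm := Computable.fst.comp (Computable.snd.comp hz)
  have hk := Computable.snd.comp (Computable.snd.comp hz)
  have hn := cAdd (cMul hN hN) hr
  have hL := Computable.list_length.comp hw
  have c2 : Computable fun _ : ((ℕ × ℕ × ℕ) × List Bool) × ((ℕ × ℕ) × (ℕ × ℕ)) => 2 :=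
    Computable.const 2
  have c0 : Computable fun _ : ((ℕ × ℕ × ℕ) × List Bool) × ((ℕ × ℕ) × (ℕ × ℕ)) => 0 :=
    Computable.const 0
  have c1 : Computable fun _ : ((ℕ × ℕ × ℕ) × List Bool) × ((ℕ × ℕ) × (ℕ × ℕ)) => 1 :=
    Computable.const 1
  have c3 : Computable fun _ : ((ℕ × ℕ × ℕ) × List Bool) × ((ℕ × ℕ) × (ℕ × ℕ)) => 3 :=
    Computable.const 3
  exact (cAnd (cEq hL (cMul hN hl)) (cAnd
    (cLt (cMul (comp_bval.comp hw) (cPow c2 hB)) (cMul (comp_gs c hj hB c0 c1 c0 c1) (cPow c2 hL)))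
    (cAnd (cLt hm (cPow c2 hn)) (cAnd
      (cLe (cAdd (comp_gs c hj hk (cAdd (hA.comp hk) c3) (cAdd hk c1) hn (cAdd hm c1)) hj)
        (cPow c2 hk))
      (cLt (cPow c2 hk) (comp_gs c hj hk (hA.comp hk) (cAdd hk c1) hn (cAdd hm c3))))))).to₂

theorem chk1_iff (c : Code) (A : ℕ → ℕ) (N l r : ℕ) (w : List Bool) (j B m k : ℕ) :
    chk1 c A ((N, l, r), w) ((j, B), (m, k)) = true ↔
      w.length = N * l ∧ bval w * 2 ^ B < gs c j B 0 1 0 1 * 2 ^ w.length ∧ m < 2 ^ (N * N + r) ∧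
      gs c j k (A k + 3) (k + 1) (N * N + r) (m + 1) + j ≤ 2 ^ k ∧
      2 ^ k < gs c j k (A k) (k + 1) (N * N + r) (m + 3) := by
  simp only [chk1, Bool.and_eq_true, decide_eq_true_eq]

section
variable {D : Set ℕ} {F T : ℝ} {c : Code} {A : ℕ → ℕ}

/-- Remaining Kraft mass after passing the threshold gives the tail estimate. -/
theorem Sys.tail' (h : Sys D F T) {S : Finset ℕ} (hS : (S : Set ℕ) ⊆ D) {n L M : ℕ}
    (hL : T * n ≤ L)
    (hM : ∀ R : Finset ℕ, (R : Set ℕ) ⊆ D → (∑ i ∈ R, (2 : ℝ) ^ (-(ln i : ℝ))) * 2 ^ L ≤ M + 1)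
    (hK : (M : ℝ) < (∑ i ∈ S, (2 : ℝ) ^ (-(ln i : ℝ))) * 2 ^ L) :
    1 - (2 : ℝ) ^ (F / T) * (2 : ℝ) ^ (-(n : ℝ)) ≤ ∑ i ∈ S, wt F T i := by
  refine h.tail hS hL fun R hR hd => ?_
  have := hM (R ∪ S) (by rw [Finset.coe_union]; exact Set.union_subset hR hS)
  rw [Finset.sum_union hd] at this
  rw [Real.rpow_neg (by norm_num), Real.rpow_natCast, ← one_div, le_div_iff₀ (by positivity)]
  linarith

theorem sound_two (h : Sys D F T) (hc1 : ∀ j, (stg c j : Set ℕ) ⊆ D)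
    (hA : ∀ k : ℕ, (A k : ℝ) ≤ (k + 1) * F ∧ (k + 1) * F ≤ A k + 3) :
    ∃ C : ℕ, ∀ (n L M j B m k : ℕ), T * n ≤ L →
      (∀ R : Finset ℕ, (R : Set ℕ) ⊆ D → (∑ i ∈ R, (2 : ℝ) ^ (-(ln i : ℝ))) * 2 ^ L ≤ M + 1) →
      M * 2 ^ B < gs c j B 0 1 0 1 * 2 ^ L → m < 2 ^ n →
      gs c j k (A k + 3) (k + 1) n (m + 1) + j ≤ 2 ^ k →
      2 ^ k < gs c j k (A k) (k + 1) n (m + 3) →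
      ⌊T * 2 ^ n⌋₊ ≤ m + 3 ∧ m + 3 ≤ ⌊T * 2 ^ n⌋₊ + C := by
  obtain ⟨C, hC0, hC⟩ := h.upper (E := (2 : ℝ) ^ (F / T)) (by positivity)
  refine ⟨⌈C⌉₊ + 3, fun n L M j B m k hL hM h1 h2 h3 h4 => ?_⟩
  have h2n : (0 : ℝ) < 2 ^ n := by positivity
  have h2k : (0 : ℝ) < 2 ^ k := by positivity
  have hT0 := h.T0
  have hK : (M : ℝ) < (∑ i ∈ stg c j, (2 : ℝ) ^ (-(ln i : ℝ))) * 2 ^ L := by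
    have a1 := gs_le c (b := 1) (M := 1) (by omega) (by omega) j B 0 0
    simp only [ex_kraft] at a1
    have a2 : (M : ℝ) * 2 ^ B < gs c j B 0 1 0 1 * 2 ^ L := by exact_mod_cast h1
    have a3 : (gs c j B 0 1 0 1 : ℝ) * 2 ^ L ≤
      2 ^ B * (∑ i ∈ stg c j, (2 : ℝ) ^ (-(ln i : ℝ))) * 2 ^ L := by gcongr
    have a4 : (0 : ℝ) < 2 ^ B := by positivity
    by_contra hc
    push Not at hc
    nlinarith
  have htail := h.tail' (hc1 j) hL hM hK
  have hs1 : ∑ i ∈ stg c j, wt F (((m + 1 : ℕ) : ℝ) / 2 ^ n) i ≤ 1 := by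
    have a1 := le_gs c (b := k + 1) (M := m + 1) (by omega) (by omega) j k (A k + 3) n
    have a2 : ((gs c j k (A k + 3) (k + 1) n (m + 1) : ℝ) + j) ≤ 2 ^ k := by exact_mod_cast h3
    have a3 : ∑ i ∈ stg c j, wt F (((m + 1 : ℕ) : ℝ) / 2 ^ n) i ≤
        ∑ i ∈ stg c j, ex (A k + 3) (k + 1) n (m + 1) i :=
      Finset.sum_le_sum fun i hi => wt_le_ex (by omega) (h.lt i (hc1 j hi)).le
        (by push_cast; exact (hA k).2)
    nlinarith
  have hs3 : 1 < ∑ i ∈ stg c j, wt F (((m + 3 : ℕ) : ℝ) / 2 ^ n) i := by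
    have a1 := gs_le c (b := k + 1) (M := m + 3) (by omega) (by omega) j k (A k) n
    have a2 : ((2 : ℝ) ^ k) < gs c j k (A k) (k + 1) n (m + 3) := by exact_mod_cast h4
    have a3 : ∑ i ∈ stg c j, ex (A k) (k + 1) n (m + 3) i ≤
        ∑ i ∈ stg c j, wt F (((m + 3 : ℕ) : ℝ) / 2 ^ n) i :=
      Finset.sum_le_sum fun i _ => ex_le_wt (by omega) (by push_cast; exact (hA k).1)
    nlinarith
  have u1 := hC n (stg c j) (((m + 1 : ℕ) : ℝ) / 2 ^ n) (hc1 j)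
    (by rw [div_le_one h2n]; exact_mod_cast h2) htail hs1
  have u2 := h.lt_of_one_lt (hc1 j) (t := ((m + 3 : ℕ) : ℝ) / 2 ^ n) (by positivity) hs3
  rw [lt_div_iff₀ h2n] at u2
  rw [Real.rpow_neg (by norm_num), Real.rpow_natCast, div_le_iff₀ h2n, add_mul, mul_assoc,
    inv_mul_cancel₀ h2n.ne', mul_one] at u1
  constructor
  · exact Nat.floor_le_of_le u2.le
  · have := Nat.lt_floor_add_one (T * 2 ^ n)
    have hc := Nat.le_ceil C
    have : ((m + 3 : ℕ) : ℝ) < ((⌊T * 2 ^ n⌋₊ + (⌈C⌉₊ + 3) : ℕ) : ℝ) := by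
      push_cast at u1 ⊢
      linarith
    exact_mod_cast this.le

theorem complete_two (h : Sys D F T) (hc1 : ∀ j, (stg c j : Set ℕ) ⊆ D)
    (hc2 : ∀ S : Finset ℕ, (S : Set ℕ) ⊆ D → ∃ j, S ⊆ stg c j)
    (hA : ∀ k : ℕ, (A k : ℝ) ≤ (k + 1) * F ∧ (k + 1) * F ≤ A k + 3) :
    ∃ n0 : ℕ, ∀ (n L M : ℕ), n0 ≤ n → T * n ≤ L →
      (∀ R : Finset ℕ, (R : Set ℕ) ⊆ D → (∑ i ∈ R, (2 : ℝ) ^ (-(ln i : ℝ))) * 2 ^ L ≤ M + 1) →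
      (∃ S : Finset ℕ, (S : Set ℕ) ⊆ D ∧ (M : ℝ) < (∑ i ∈ S, (2 : ℝ) ^ (-(ln i : ℝ))) * 2 ^ L) →
      ∃ j B m k : ℕ, M * 2 ^ B < gs c j B 0 1 0 1 * 2 ^ L ∧ m < 2 ^ n ∧
        gs c j k (A k + 3) (k + 1) n (m + 1) + j ≤ 2 ^ k ∧
        2 ^ k < gs c j k (A k) (k + 1) n (m + 3) := by
  obtain ⟨n0, hn0⟩ := h.exists_m (E := (2 : ℝ) ^ (F / T)) (by positivity)
  refine ⟨n0, fun n L M hn hL hM ⟨S, hSD, hS⟩ => ?_⟩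
  obtain ⟨j, hj⟩ := hc2 S hSD
  set K := ∑ i ∈ stg c j, (2 : ℝ) ^ (-(ln i : ℝ)) with hKd
  have hK : (M : ℝ) < K * 2 ^ L := hS.trans_le (by
    have : ∑ i ∈ S, (2 : ℝ) ^ (-(ln i : ℝ)) ≤ K :=
      Finset.sum_le_sum_of_subset_of_nonneg hj fun i _ _ => by positivity
    gcongr)
  obtain ⟨B, hB⟩ : ∃ B : ℕ, M * 2 ^ B < gs c j B 0 1 0 1 * 2 ^ L := by
    have hpos : 0 < K * 2 ^ L - M := by linarith
    obtain ⟨B, hB⟩ := pow_unbounded_of_one_lt ((j : ℝ) * 2 ^ L / (K * 2 ^ L - M))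
      (show (1 : ℝ) < 2 by norm_num)
    rw [div_lt_iff₀ hpos] at hB
    refine ⟨B, ?_⟩
    have a1 := le_gs c (b := 1) (M := 1) (by omega) (by omega) j B 0 0
    simp only [ex_kraft] at a1
    rw [← hKd] at a1
    have a2 : 2 ^ B * K * 2 ^ L ≤ ((gs c j B 0 1 0 1 : ℝ) + j) * 2 ^ L := by gcongr
    have : (M : ℝ) * 2 ^ B < gs c j B 0 1 0 1 * 2 ^ L := by nlinarith
    exact_mod_cast this
  obtain ⟨m, hm, m1, m3⟩ := hn0 n hn (stg c j) (hc1 j) (h.tail' (hc1 j) hL hM hK)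
  have hF : ∀ i ∈ stg c j, F ≤ ln i := fun i hi => (h.lt i (hc1 j hi)).le
  have l1 := gs_tendsto c (M := m + 1) (by omega) n j (fun k => A k + 3) (tendsto_of_approx hA).2 hF
  have l3 := gs_tendsto c (M := m + 3) (by omega) n j A (tendsto_of_approx hA).1 hF
  have lj : Tendsto (fun k : ℕ => (j : ℝ) / 2 ^ k) atTop (𝓝 0) :=
    tendsto_const_nhds.div_atTop (tendsto_pow_atTop_atTop_of_one_lt (by norm_num))
  have l1' := l1.add lj
  rw [add_zero] at l1'
  obtain ⟨k, k1, k3⟩ :=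
    ((l1'.eventually (gt_mem_nhds m1)).and (l3.eventually (lt_mem_nhds m3))).exists
  refine ⟨j, B, m, k, hB, hm, ?_, ?_⟩
  · rw [← add_div, div_lt_one (by positivity)] at k1
    exact_mod_cast k1.le
  · rw [one_lt_div (by positivity)] at k3
    exact_mod_cast k3
end

end PartTwo

section PartTwoFinal
open Nat.Partrec (Code)
open Filter Topology

/-- Self-delimiting encoding of the data given to the decoder. -/
def enc (x : ((ℕ × ℕ × ℕ) × List Bool) × ℕ) : List Bool :=
  un x.1.1.1 ++ (un x.1.1.2.1 ++ (un x.1.1.2.2 ++ (un x.2 ++ x.1.2)))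

theorem comp_enc : Computable enc := by
  have hy : Computable fun a : ((ℕ × ℕ × ℕ) × List Bool) × ℕ => a.1 := Computable.fst
  have hN := Computable.fst.comp (Computable.fst.comp hy)
  have hl := Computable.fst.comp (Computable.snd.comp (Computable.fst.comp hy))
  have hr := Computable.snd.comp (Computable.snd.comp (Computable.fst.comp hy))
  have ho : Computable fun a : ((ℕ × ℕ × ℕ) × List Bool) × ℕ => a.2 := Computable.snd
  exact Computable.list_append.comp (comp_un.comp hN) (Computable.list_append.comp (comp_un.comp hl)
    (Computable.list_append.comp (comp_un.comp hr) (Computable.list_append.comp (comp_un.comp ho)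
      (Computable.snd.comp hy))))

theorem enc_pfx_eq {N l r o N' l' r' o' : ℕ} {w w' : List Bool}
    (h : enc (((N, l, r), w), o) <+: enc (((N', l', r'), w'), o')) :
    N = N' ∧ l = l' ∧ r = r' ∧ o = o' ∧ w <+: w' := by
  obtain ⟨h1, h⟩ := un_pfx_eq h
  obtain ⟨h2, h⟩ := un_pfx_eq h
  obtain ⟨h3, h⟩ := un_pfx_eq h
  obtain ⟨h4, h⟩ := un_pfx_eq h
  exact ⟨h1, h2, h3, h4, h⟩

theorem enc_inj : Function.Injective enc := by
  rintro ⟨⟨⟨N, l, r⟩, w⟩, o⟩ ⟨⟨⟨N', l', r'⟩, w'⟩, o'⟩ h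
  have p1 : enc (((N, l, r), w), o) <+: enc (((N', l', r'), w'), o') := by rw [h]
  have p2 : enc (((N', l', r'), w'), o') <+: enc (((N, l, r), w), o) := by rw [h]
  obtain ⟨rfl, rfl, rfl, rfl, h1⟩ := enc_pfx_eq p1
  obtain ⟨-, -, -, -, h2⟩ := enc_pfx_eq p2
  rw [h1.eq_of_length_le h2.length_le]

theorem main_bound {U V : Computer} (hU : Optimal U) (hV : Optimal V) {T : ℝ} (h0 : 0 < T)
    (h1 : T < 1) (hF : ComputableReal (Ffun V T)) :
    ∃ n0 K : ℕ, ∀ n ≥ n0,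
      (complexity U (firstBits T n) : ℝ) ≤ T * n + 7 * Real.sqrt n + K := by
  have hS := sys_of hV h0 h1
  obtain ⟨c, hc1, hc2, -⟩ := exists_stage_code V
  obtain ⟨A, hAc, hA⟩ := exists_nat_approx hS.F0 hF
  obtain ⟨C, hC⟩ := sound_two hS hc1 hA
  obtain ⟨n0, hn0⟩ := complete_two hS hc1 hc2 hA
  obtain ⟨f1, hf1p, hf1s, hf1c⟩ := exists_search (comp_chk1 c hAc)
  let chk2 : (((ℕ × ℕ × ℕ) × List Bool) × ℕ) × ((ℕ × ℕ) × (ℕ × ℕ)) → List Bool → Bool :=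
    fun a v => decide (v.length = a.1.1.1.1 * a.1.1.1.1 + a.1.1.1.2.2) &&
      decide (bval v + a.1.2 = a.2.2.1 + 3)
  have hchk2 : Computable₂ chk2 := by
    have ha : Computable fun b : ((((ℕ × ℕ × ℕ) × List Bool) × ℕ) × ((ℕ × ℕ) × (ℕ × ℕ))) ×
      List Bool => b.1 := Computable.fst
    have hv : Computable fun b : ((((ℕ × ℕ × ℕ) × List Bool) × ℕ) × ((ℕ × ℕ) × (ℕ × ℕ))) ×
      List Bool => b.2 := Computable.snd
    have hx := Computable.fst.comp ha
    have hy := Computable.fst.comp (Computable.fst.comp hx)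
    have hN := Computable.fst.comp hy
    have hr := Computable.snd.comp (Computable.snd.comp hy)
    have hm := Computable.fst.comp (Computable.snd.comp (Computable.snd.comp ha))
    exact (cAnd (cEq (Computable.list_length.comp hv) (cAdd (cMul hN hN) hr))
      (cEq (cAdd (comp_bval.comp hv) (Computable.snd.comp hx)) (cAdd hm (Computable.const 3)))).to₂
  obtain ⟨f2, hf2p, hf2s, hf2c⟩ := exists_search hchk2
  let g : (((ℕ × ℕ × ℕ) × List Bool) × ℕ) →. List Bool := fun x =>
    (f1 x.1).bind fun z => f2 (x, z)
  have hg : Partrec g := (hf1p.comp Computable.fst).bind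
    (hf2p.comp (Computable.fst.pair Computable.snd)).to₂
  have hlen : ∀ N l r w o, (g (((N, l, r), w), o)).Dom → w.length = N * l := by
    intro N l r w o hd
    obtain ⟨s, hs⟩ := Part.dom_iff_mem.1 hd
    obtain ⟨⟨⟨j, B⟩, m, k⟩, hz, -⟩ := Part.mem_bind_iff.1 hs
    exact ((chk1_iff _ _ _ _ _ _ _ _ _ _).1 (hf1s _ _ hz)).1
  have hpf : ∀ x y, (g x).Dom → (g y).Dom → enc x <+: enc y → x = y := by
    rintro ⟨⟨⟨N, l, r⟩, w⟩, o⟩ ⟨⟨⟨N', l', r'⟩, w'⟩, o'⟩ d1 d2 h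
    obtain ⟨rfl, rfl, rfl, rfl, hw⟩ := enc_pfx_eq h
    rw [hw.eq_of_length ((hlen _ _ _ _ _ d1).trans (hlen _ _ _ _ _ d2).symm)]
  obtain ⟨d, hd⟩ := coding hU enc comp_enc enc_inj g hg hpf
  refine ⟨n0, C + d + 7, fun n hn => ?_⟩
  set N := Nat.sqrt n with hN
  have hN1 : N * N ≤ n := Nat.sqrt_le n
  have hN2 : n ≤ N * N + N + N := Nat.sqrt_le_add n
  obtain ⟨r, hr⟩ : ∃ r, n = N * N + r := ⟨n - N * N, by omega⟩
  set l := ⌈T * (N + 2)⌉₊ with hl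
  have hl1 : T * (N + 2) ≤ l := Nat.le_ceil _
  have hl2 : (l : ℝ) < T * (N + 2) + 1 := Nat.ceil_lt_add_one (by positivity)
  have hNr : (0 : ℝ) ≤ N := by positivity
  have hrr : (n : ℝ) = N * N + r := by exact_mod_cast hr
  have hr0 : (0 : ℝ) ≤ r := by positivity
  have hr2 : (r : ℝ) ≤ 2 * N := by
    have : r ≤ 2 * N := by omega
    exact_mod_cast this
  have hL1 : T * n ≤ ((N * l : ℕ) : ℝ) := by
    push_cast; rw [hrr]; nlinarith
  have hL2 : ((N * l : ℕ) : ℝ) ≤ T * n + 3 * N := by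
    push_cast; rw [hrr]
    have a1 : (N : ℝ) * l ≤ N * (T * (N + 2) + 1) := by gcongr
    have a2 : 0 ≤ T * r := by positivity
    have a3 : T * N ≤ N := by nlinarith
    nlinarith
  obtain ⟨M, hM1, hM2, hM3⟩ := hS.exists_M (N * l)
  obtain ⟨w, hw1, hw2⟩ := exists_bval (N * l) M hM1
  have hdom : (f1 ((N, l, r), w)).Dom := by
    obtain ⟨j, B, m, k, q1, q2, q3, q4⟩ := hn0 n (N * l) M hn hL1 hM2 hM3
    apply hf1c _ ((j, B), (m, k))
    rw [chk1_iff, hw1, hw2, ← hr]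
    exact ⟨rfl, q1, q2, q3, q4⟩
  obtain ⟨⟨⟨j, B⟩, m, k⟩, hz⟩ := Part.dom_iff_mem.1 hdom
  have hz' := (chk1_iff _ _ _ _ _ _ _ _ _ _).1 (hf1s _ _ hz)
  rw [hw1, hw2, ← hr] at hz'
  obtain ⟨-, q1, q2, q3, q4⟩ := hz'
  obtain ⟨b1, b2⟩ := hC n (N * l) M j B m k hL1 hM2 q1 q2 q3 q4
  obtain ⟨o, ho⟩ : ∃ o, m + 3 = ⌊T * 2 ^ n⌋₊ + o := ⟨m + 3 - ⌊T * 2 ^ n⌋₊, by omega⟩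
  have hxb : bval (firstBits T n) = ⌊T * 2 ^ n⌋₊ := bval_firstBits T h0.le h1 n
  have hmem : firstBits T n ∈ g (((N, l, r), w), o) := by
    refine Part.mem_bind_iff.2 ⟨_, hz, ?_⟩
    have hd2 : (f2 ((((N, l, r), w), o), ((j, B), (m, k)))).Dom := by
      apply hf2c _ (firstBits T n)
      simp only [chk2, Bool.and_eq_true, decide_eq_true_eq]
      exact ⟨by rw [firstBits_length, ← hr], by omega⟩
    obtain ⟨v, hv⟩ := Part.dom_iff_mem.1 hd2
    have hv' := hf2s _ _ hv
    simp only [chk2, Bool.and_eq_true, decide_eq_true_eq] at hv'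
    have : v = firstBits T n := bval_inj (by rw [hv'.1, firstBits_length, ← hr]) (by omega)
    rwa [← this]
  obtain ⟨q, hq1, hq2⟩ := hd _ _ hmem
  have hc := complexity_le hq1
  have hel : (enc (((N, l, r), w), o)).length = N + l + r + o + 4 + N * l := by
    simp only [enc, List.length_append, un_length, hw1]; ring
  rw [hel] at hq2
  have ho' : o ≤ C := by omega
  have tot : (complexity U (firstBits T n) : ℝ) ≤ N + l + r + C + 4 + ((N * l : ℕ) : ℝ) + d := by
    have : complexity U (firstBits T n) ≤ N + l + r + C + 4 + N * l + d := by omega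
    exact_mod_cast this
  have hsq : (N : ℝ) ≤ Real.sqrt n := by
    apply Real.le_sqrt_of_sq_le
    rw [sq]; exact_mod_cast hN1
  have hl3 : (l : ℝ) ≤ N + 3 := by nlinarith
  push_cast at tot hL2 ⊢
  linarith

theorem part_two {U V : Computer} (hU : Optimal U) (hV : Optimal V) {T : ℝ} (h0 : 0 < T)
    (h1 : T < 1) (hF : ComputableReal (Ffun V T)) : TCompressible U T T := by
  obtain ⟨n0, K, h⟩ := main_bound hU hV h0 h1 hF
  set K1 := ∑ i ∈ Finset.range n0, complexity U (firstBits T i) with hK1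
  refine ⟨fun n => 7 * Real.sqrt n + (K + K1 : ℕ), ?_, fun n _ => ?_⟩
  · have hs : Tendsto (fun n : ℕ => Real.sqrt (n : ℝ)) atTop atTop :=
      Real.tendsto_sqrt_atTop.comp tendsto_natCast_atTop_atTop
    have e1 : Tendsto (fun n : ℕ => (7 : ℝ) / Real.sqrt n) atTop (𝓝 0) :=
      tendsto_const_nhds.div_atTop hs
    have e2 : Tendsto (fun n : ℕ => ((K + K1 : ℕ) : ℝ) / (n : ℝ)) atTop (𝓝 0) :=
      tendsto_const_nhds.div_atTop tendsto_natCast_atTop_atTop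
    have e3 := e1.add e2
    rw [add_zero] at e3
    refine e3.congr fun n => ?_
    rw [add_div, mul_div_assoc, Real.sqrt_div_self', mul_one_div]
  · have hT : 0 ≤ T * n := by positivity
    have hsq := Real.sqrt_nonneg (n : ℝ)
    push_cast
    have hk0 : (0 : ℝ) ≤ K := by positivity
    have hk1 : (0 : ℝ) ≤ K1 := by positivity
    by_cases hn : n < n0
    · have : complexity U (firstBits T n) ≤ K1 :=
        Finset.single_le_sum (f := fun i => complexity U (firstBits T i))
          (fun _ _ => Nat.zero_le _) (Finset.mem_range.2 hn)
      have : (complexity U (firstBits T n) : ℝ) ≤ K1 := by exact_mod_cast this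
      linarith
    · have := h n (by omega)
      linarith

end PartTwoFinal

/-- Fixed point theorem for `F`. If `V` is optimal, `T ∈ (0,1)`
and `F_V(T)` is computable, then `T` is weakly Chaitin `T`-random and
`T`-compressible. -/
theorem fixedPoint_of_freeEnergy_computable
    (U : Computer) (hU : Optimal U) (V : Computer) (hV : Optimal V)
    (T : ℝ) (hT : T ∈ Set.Ioo (0 : ℝ) 1) (hF : ComputableReal (Ffun V T)) :
    WeaklyChaitinTRandom U T T ∧ TCompressible U T T := by
  exact ⟨part_one hU hV hT.1 hT.2 hF, part_two hU hV hT.1 hT.2 hF⟩
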